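/- arXiv:0812.0820 — 4 statements merged into one kernel-verified Lean document; each statement's English description precedes it below -/
import Mathlib

section
/- Suppose there are v ∈ M^ac(E) with v ≥ 0, measurable ℓ, k : E → [0,∞), measurable p : ∂E → [0,∞), a constant d ≥ 0, α ∈ ℝ, and for each x ∈ E a relaxed control Θ(x) = (μ(x), μ∂(x)) ∈ V^r(x) such that: (i) Λ^{μ(x)}(x,t) < ∞ and 𝓛_α(x,Θ(x)) < ∞ for all x ∈ E and t ∈ [0,t*(x)); (ii) for all x ∈ E and t ∈ [0,t*(x)): Xv(φ(x,t)) − [α + λ(φ(x,t),μ(x,t))]·v(φ(x,t)) + ℓ(φ(x,t)) + λQk(φ(x,t),μ(x,t)) ≤ d; (iii) for all x ∈ E with t*(x) < ∞: v(φ(x,t*(x))) ≥ p(φ(x,t*(x))) + Qk(φ(x,t*(x)), μ∂(x)). Then for every x ∈ E (with all terms valued in [0,∞]): v(x) + d·𝓛_α(x,Θ(x)) ≥ L_α ℓ(x,Θ(x)) + H_α p(x,Θ(x)) + G_α k(x,Θ(x)). -/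
open MeasureTheory ENNReal Set Filter Topology

namespace PDMP

noncomputable section

/-- Data of a controlled PDMP: state space `E ⊆ ℝⁿ`, flow `φ`, feasible action sets `feas = 𝕌`,
jump rate `lam = λ` and transition kernel `Q`. -/
structure Setting (n : ℕ) (U : Type*) [MeasurableSpace U] where
  E : Set (Fin n → ℝ)
  φ : (Fin n → ℝ) → ℝ → (Fin n → ℝ)
  feas : (Fin n → ℝ) → Set U
  lam : (Fin n → ℝ) → U → ℝ
  Q : (Fin n → ℝ) → U → Measure (Fin n → ℝ)

/-- A relaxed control: a time component (measures on the action space along the flow) and a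
boundary component. -/
structure RControl (U : Type*) [MeasurableSpace U] where
  time : ℝ → Measure U
  bdry : Measure U

variable {n : ℕ} {U : Type*} [MeasurableSpace U]

namespace Setting

variable (S : Setting n U)

/-- The exit time `t*(x)` from `E`, valued in `[0,∞]` (`∞` if the flow never reaches `∂E`). -/
def ts (x : Fin n → ℝ) : ℝ≥0∞ :=
  sInf {T : ℝ≥0∞ | ∃ t : ℝ, 0 < t ∧ S.φ x t ∈ frontier S.E ∧ T = ENNReal.ofReal t}

/-- Real version of the exit time (junk value `0` when `t*(x) = ∞`). -/
def tsR (x : Fin n → ℝ) : ℝ := (S.ts x).toReal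

/-- The time interval `[0, t*(x))` as a subset of `ℝ`. -/
def fs (x : Fin n → ℝ) : Set ℝ := {t : ℝ | 0 ≤ t ∧ ENNReal.ofReal t < S.ts x}

/-- `λ(y,μ) = ∫ λ(y,u) μ(du)`, as an extended nonnegative real. -/
def lamMix (y : Fin n → ℝ) (m : Measure U) : ℝ≥0∞ := ∫⁻ u, ENNReal.ofReal (S.lam y u) ∂m

/-- `Q k (y,a) = ∫_E k(z) Q(y,a;dz)`. -/
def Qpt (k : (Fin n → ℝ) → ℝ≥0∞) (y : Fin n → ℝ) (a : U) : ℝ≥0∞ := ∫⁻ z in S.E, k z ∂(S.Q y a)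

/-- `Q k (y,μ) = ∫∫_E k(z) Q(y,u;dz) μ(du)`. -/
def QMix (k : (Fin n → ℝ) → ℝ≥0∞) (y : Fin n → ℝ) (m : Measure U) : ℝ≥0∞ :=
  ∫⁻ u, S.Qpt k y u ∂m

/-- `λQ k (y,μ) = ∫ λ(y,u) ∫_E k(z) Q(y,u;dz) μ(du)`. -/
def lamQMix (k : (Fin n → ℝ) → ℝ≥0∞) (y : Fin n → ℝ) (m : Measure U) : ℝ≥0∞ :=
  ∫⁻ u, ENNReal.ofReal (S.lam y u) * S.Qpt k y u ∂m

/-- `Λ^μ(x,t) = ∫_0^t λ(φ(x,s), μ(s)) ds`. -/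
def Lam (x : Fin n → ℝ) (Θ : RControl U) (t : ℝ) : ℝ≥0∞ :=
  ∫⁻ s in Set.Ioc (0 : ℝ) t, S.lamMix (S.φ x s) (Θ.time s)

/-- The integrating factor `e^{-α t - Λ^μ(x,t)}` (equal to `0` when `Λ^μ(x,t) = ∞`). -/
def weight (α : ℝ) (x : Fin n → ℝ) (Θ : RControl U) (t : ℝ) : ℝ≥0∞ :=
  if S.Lam x Θ t = ⊤ then 0 else ENNReal.ofReal (Real.exp (-(α * t) - (S.Lam x Θ t).toReal))

/-- `𝓛_α(x,Θ) = ∫_0^{t*(x)} e^{-α s - Λ^μ(x,s)} ds`. -/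
def curlyL (α : ℝ) (x : Fin n → ℝ) (Θ : RControl U) : ℝ≥0∞ :=
  ∫⁻ t in S.fs x, S.weight α x Θ t

/-- `L_α v(x,Θ) = ∫_0^{t*(x)} e^{-α s - Λ^μ(x,s)} v(φ(x,s), μ(s)) ds`. -/
def Lop (α : ℝ) (v : (Fin n → ℝ) → Measure U → ℝ≥0∞) (x : Fin n → ℝ) (Θ : RControl U) :
    ℝ≥0∞ :=
  ∫⁻ t in S.fs x, S.weight α x Θ t * v (S.φ x t) (Θ.time t)

/-- `H_α w(x,Θ) = e^{-α t*(x) - Λ^μ(x,t*(x))} w(φ(x,t*(x)), μ∂)` when `t*(x) < ∞`, else `0`. -/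
def Hop (α : ℝ) (p : (Fin n → ℝ) → Measure U → ℝ≥0∞) (x : Fin n → ℝ) (Θ : RControl U) :
    ℝ≥0∞ :=
  if S.ts x < ⊤ then S.weight α x Θ (S.tsR x) * p (S.φ x (S.tsR x)) Θ.bdry else 0

/-- `G_α k(x,Θ)` for nonnegative `k`. -/
def Gop (α : ℝ) (k : (Fin n → ℝ) → ℝ≥0∞) (x : Fin n → ℝ) (Θ : RControl U) : ℝ≥0∞ :=
  S.Lop α (fun y m => S.lamQMix k y m) x Θ + S.Hop α (fun y m => S.QMix k y m) x Θ

/-- `G_α h(x,Θ)` for signed `h`, as `G_α h⁺ - G_α h⁻` in the extended reals. -/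
def GopS (α : ℝ) (h : (Fin n → ℝ) → ℝ) (x : Fin n → ℝ) (Θ : RControl U) : EReal :=
  ((S.Gop α (fun z => ENNReal.ofReal (h z)) x Θ : ℝ≥0∞) : EReal)
    - ((S.Gop α (fun z => ENNReal.ofReal (-h z)) x Θ : ℝ≥0∞) : EReal)

/-- Admissibility of a relaxed control at `x`, i.e. membership in `V^r(x)`. -/
def IsRelaxed (x : Fin n → ℝ) (Θ : RControl U) : Prop :=
  Measurable Θ.time ∧ (∀ t, IsProbabilityMeasure (Θ.time t)) ∧
    (∀ᵐ t ∂(volume.restrict (S.fs x)), Θ.time t (S.feas (S.φ x t)) = 1) ∧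
    IsProbabilityMeasure Θ.bdry ∧
    (S.ts x < ⊤ → Θ.bdry (S.feas (S.φ x (S.tsR x))) = 1)

/-- The relaxed control `u_φ(x)` induced by a feedback selector `u`. -/
def feedback (u : (Fin n → ℝ) → U) (x : Fin n → ℝ) : RControl U :=
  ⟨fun t => Measure.dirac (u (S.φ x t)), Measure.dirac (u (S.φ x (S.tsR x)))⟩

/-- Ordinary feedback measurable selectors: `u(y) ∈ 𝕌(y)`. -/
def IsSelector (u : (Fin n → ℝ) → U) : Prop :=
  Measurable u ∧ ∀ y ∈ closure S.E, u y ∈ S.feas y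

/-- Membership of `v` in `M^ac(E)` with derivative `Xv` along the flow; boundary values of `v`
are the limits along the flow. -/
def MemMac (v Xv : (Fin n → ℝ) → ℝ) : Prop :=
  Measurable v ∧ Measurable Xv ∧
    (∀ x ∈ S.E, ∀ t ∈ S.fs x,
      IntervalIntegrable (fun s => Xv (S.φ x s)) volume 0 t ∧
        v (S.φ x t) - v x = ∫ s in (0 : ℝ)..t, Xv (S.φ x s)) ∧
    (∀ x ∈ S.E, S.ts x < ⊤ →
      Tendsto (fun t => v (S.φ x t)) (𝓝[<] S.tsR x) (𝓝 (v (S.φ x (S.tsR x)))))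

/-- The weighted supremum norm `‖h‖_g = sup_{x ∈ E} |h(x)|/g(x)`. -/
def gnorm (h g : (Fin n → ℝ) → ℝ) : ℝ := sSup ((fun x => |h x| / g x) '' S.E)

/-- Membership in `B_g(E)`. -/
def memBg (h g : (Fin n → ℝ) → ℝ) : Prop :=
  Measurable h ∧ BddAbove ((fun x => |h x| / g x) '' S.E)

/-- `v(y,μ) = ∫ v(y,u) μ(du)` for a nonnegative cost `v` on `Ē × U`, as a function of the
state and a measure on actions. -/
def mix (_S : Setting n U) (v : (Fin n → ℝ) → U → ℝ) : (Fin n → ℝ) → Measure U → ℝ≥0∞ :=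
  fun y m => ∫⁻ u, ENNReal.ofReal (v y u) ∂m

/-- The quantity `-ρ 𝓛_α(x,Θ) + L_α f(x,Θ) + H_α r(x,Θ) + G_α h(x,Θ)` appearing in the
one-stage optimization problems, valued in the extended reals. -/
def oneStage (α ρ : ℝ) (f r : (Fin n → ℝ) → U → ℝ) (h : (Fin n → ℝ) → ℝ) (x : Fin n → ℝ)
    (Θ : RControl U) : EReal :=
  (-(ρ : EReal)) * ((S.curlyL α x Θ : ℝ≥0∞) : EReal)
    + ((S.Lop α (S.mix f) x Θ : ℝ≥0∞) : EReal)
    + ((S.Hop α (S.mix r) x Θ : ℝ≥0∞) : EReal) + S.GopS α h x Θ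

end Setting

/-- The basic structural assumptions on the data of the control problem. -/
structure Basic [TopologicalSpace U] (S : Setting n U) : Prop where
  openE : IsOpen S.E
  nonemptyE : S.E.Nonempty
  contFlow : Continuous (Function.uncurry S.φ)
  flowZero : ∀ x, S.φ x 0 = x
  flowAdd : ∀ x s t, 0 ≤ s → 0 ≤ t → S.φ x (s + t) = S.φ (S.φ x s) t
  feasCompact : ∀ y ∈ closure S.E, IsCompact (S.feas y)
  feasNonempty : ∀ y ∈ closure S.E, (S.feas y).Nonempty
  lamMeas : Measurable (Function.uncurry S.lam)
  lamNonneg : ∀ y ∈ closure S.E, ∀ u, 0 ≤ S.lam y u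
  Qprob : ∀ y u, IsProbabilityMeasure (S.Q y u)
  QsuppE : ∀ y u, S.Q y u S.E = 1
  Qmeas : Measurable fun p : (Fin n → ℝ) × U => S.Q p.1 p.2

/-- The expected growth condition (Assumption 3.1 of the paper, inequalities (Cu1)/(Cu2)). -/
structure ExpGrowth (S : Setting n U) (b c : ℝ) (g Xg rbar : (Fin n → ℝ) → ℝ) : Prop where
  b_nonneg : 0 ≤ b
  c_pos : 0 < c
  g_ge_one : ∀ y, 1 ≤ g y
  g_mac : S.MemMac g Xg
  rbar_meas : Measurable rbar
  rbar_nonneg : ∀ z ∈ frontier S.E, 0 ≤ rbar z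
  drift : ∀ x ∈ S.E, ∀ a ∈ S.feas x,
    ((Xg x + c * g x : ℝ) : EReal)
        + ((ENNReal.ofReal (S.lam x a) * S.Qpt (fun z => ENNReal.ofReal (g z)) x a : ℝ≥0∞) :
            EReal)
      ≤ ((b + S.lam x a * g x : ℝ) : EReal)
  bdryGrowth : ∀ x ∈ S.E, S.ts x < ⊤ → ∀ a ∈ S.feas (S.φ x (S.tsR x)),
    ENNReal.ofReal (rbar (S.φ x (S.tsR x)))
        + S.Qpt (fun z => ENNReal.ofReal (g z)) (S.φ x (S.tsR x)) a
      ≤ ENNReal.ofReal (g (S.φ x (S.tsR x)))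

/-- The full expected growth condition: the bounds on the running and boundary costs
(inequalities (Cu3)/(Cu3a) of Assumption 3.1 of the paper). -/
structure CostBound (S : Setting n U) (c δ M : ℝ) (g rbar : (Fin n → ℝ) → ℝ)
    (f r : (Fin n → ℝ) → U → ℝ) : Prop where
  δ_pos : 0 < δ
  M_nonneg : 0 ≤ M
  f_meas : Measurable (Function.uncurry f)
  f_nonneg : ∀ y ∈ closure S.E, ∀ u, 0 ≤ f y u
  r_meas : Measurable (Function.uncurry r)
  r_nonneg : ∀ z ∈ frontier S.E, ∀ u, 0 ≤ r z u
  f_bound : ∀ x ∈ S.E, ∀ a ∈ S.feas x, f x a ≤ M * g x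
  r_bound : ∀ x ∈ S.E, S.ts x < ⊤ → ∀ a ∈ S.feas (S.φ x (S.tsR x)),
    r (S.φ x (S.tsR x)) a ≤ M / (c + δ) * rbar (S.φ x (S.tsR x))

/-- The lower-rate condition (parts of Assumptions 3.2 and 3.7 of the paper). -/
structure LowerRate (S : Setting n U) (c : ℝ) (lamL : (Fin n → ℝ) → ℝ) (Kl : ℝ) : Prop where
  lamL_meas : Measurable lamL
  lamL_nonneg : ∀ y, 0 ≤ lamL y
  Kl_nonneg : 0 ≤ Kl
  lam_ge : ∀ y ∈ S.E, ∀ a ∈ S.feas y, lamL y ≤ S.lam y a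
  lamL_locInt : ∀ x ∈ S.E, ∀ t ∈ S.fs x,
    IntervalIntegrable (fun s => lamL (S.φ x s)) volume 0 t
  lamL_intTs : ∀ x ∈ S.E, S.ts x < ⊤ →
    IntervalIntegrable (fun s => lamL (S.φ x s)) volume 0 (S.tsR x)
  intBound : ∀ x ∈ S.E,
    (∫⁻ t in S.fs x,
        ENNReal.ofReal (Real.exp (c * t - ∫ s in (0 : ℝ)..t, lamL (S.φ x s))))
      ≤ ENNReal.ofReal Kl
  supInt : ∀ x ∈ S.E, ∀ t ∈ S.fs x,
    (∫⁻ s in Set.Ioc (0 : ℝ) t, ⨆ a ∈ S.feas (S.φ x s), ENNReal.ofReal (S.lam (S.φ x s) a)) < ⊤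
  supIntTs : ∀ x ∈ S.E, S.ts x < ⊤ →
    (∫⁻ s in Set.Ioc (0 : ℝ) (S.tsR x),
        ⨆ a ∈ S.feas (S.φ x s), ENNReal.ofReal (S.lam (S.φ x s) a)) < ⊤

end

end PDMP

open PDMP MeasureTheory ENNReal Set Filter Topology

lemma aux_ac_exp {A : ℝ → ℝ} {a b : ℝ} (hA : AbsolutelyContinuousOnInterval A a b) :
    AbsolutelyContinuousOnInterval (fun t => Real.exp (-A t)) a b := by
  obtain ⟨C, hC⟩ := hA.exists_bound
  have key : ∀ p q : ℝ, |p| ≤ C → |q| ≤ C →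
      |Real.exp (-p) - Real.exp (-q)| ≤ Real.exp C * |p - q| := by
    have h1 : ∀ p q : ℝ, |p| ≤ C → p ≤ q →
        |Real.exp (-p) - Real.exp (-q)| ≤ Real.exp C * |p - q| := by
      intro p q hp hpq
      have e1 : Real.exp (-q) ≤ Real.exp (-p) := Real.exp_le_exp.2 (by linarith)
      rw [abs_of_nonneg (by linarith), abs_of_nonpos (by linarith)]
      have e2 : Real.exp (-q) = Real.exp (-p) * Real.exp (p - q) := by
        rw [← Real.exp_add]; congr 1; ring
      have e3 := Real.add_one_le_exp (p - q)
      have e4 : Real.exp (-p) ≤ Real.exp C := Real.exp_le_exp.2 (by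
        have := neg_abs_le p; linarith)
      have e5 := Real.exp_pos (-p)
      rw [e2]
      calc Real.exp (-p) - Real.exp (-p) * Real.exp (p - q)
          = Real.exp (-p) * (1 - Real.exp (p - q)) := by ring
        _ ≤ Real.exp (-p) * (-(p - q)) := by
            apply mul_le_mul_of_nonneg_left _ e5.le; linarith
        _ ≤ Real.exp C * (-(p - q)) := by
            apply mul_le_mul_of_nonneg_right e4; linarith
    intro p q hp hq
    rcases le_total p q with h | h
    · exact h1 p q hp h
    · rw [abs_sub_comm, abs_sub_comm p q]; exact h1 q p hq h
  rw [absolutelyContinuousOnInterval_iff] at hA ⊢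
  intro ε hε
  obtain ⟨δ, hδ, h⟩ := hA (ε / Real.exp C) (by positivity)
  refine ⟨δ, hδ, fun E hE hEδ => ?_⟩
  have h2 := h E hE hEδ
  rw [lt_div_iff₀ (Real.exp_pos C)] at h2
  refine lt_of_le_of_lt ?_ h2
  rw [Finset.sum_mul]
  refine Finset.sum_le_sum fun i hi => ?_
  rw [mul_comm, Real.dist_eq, Real.dist_eq]
  have := hE.1 i hi
  exact key _ _ (hC _ this.1) (hC _ this.2)

/-- Integrating-factor identity. -/
lemma aux_identity (a b V : ℝ → ℝ) (T : ℝ) (hT : 0 ≤ T)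
    (ha : IntervalIntegrable a volume 0 T) (hb : IntervalIntegrable b volume 0 T)
    (hV : ∀ t ∈ Icc 0 T, V t - V 0 = ∫ s in (0:ℝ)..t, b s) :
    IntervalIntegrable (fun t => Real.exp (-∫ s in (0:ℝ)..t, a s) * (b t - a t * V t))
      volume 0 T ∧
    ∫ t in (0:ℝ)..T, Real.exp (-∫ s in (0:ℝ)..t, a s) * (b t - a t * V t)
      = Real.exp (-∫ s in (0:ℝ)..T, a s) * V T - V 0 := by
  set A : ℝ → ℝ := fun t => ∫ s in (0:ℝ)..t, a s with hAdef
  have h0 : (0:ℝ) ∈ uIcc 0 T := left_mem_uIcc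
  have hA : AbsolutelyContinuousOnInterval A 0 T :=
    ha.absolutelyContinuousOnInterval_intervalIntegral h0
  have hW := aux_ac_exp hA
  have hB : AbsolutelyContinuousOnInterval (fun t => ∫ s in (0:ℝ)..t, b s) 0 T :=
    hb.absolutelyContinuousOnInterval_intervalIntegral h0
  have hc : AbsolutelyContinuousOnInterval (fun _ : ℝ => V 0) 0 T :=
    (contDiff_const.contDiffOn).absolutelyContinuousOnInterval
  have hG := hc.fun_add hB
  have hF := hW.fun_mul hG
  have hintg := hF.intervalIntegrable_deriv
  have hftc := hF.integral_deriv_eq_sub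
  have hae : ∀ᵐ t : ℝ, t ∈ uIoc 0 T →
      deriv (fun t => Real.exp (-A t) * (V 0 + ∫ s in (0:ℝ)..t, b s)) t =
        Real.exp (-A t) * (b t - a t * V t) := by
    filter_upwards [ha.ae_hasDerivAt_integral, hb.ae_hasDerivAt_integral] with t h1 h2 ht
    have ht' : t ∈ uIcc 0 T := uIoc_subset_uIcc ht
    have d1 := h1 ht' 0 h0
    have d2 := h2 ht' 0 h0
    have d3 := (d1.neg.exp).mul (d2.const_add (V 0))
    have := d3.deriv
    have hVt := hV t (by rwa [uIcc_of_le hT] at ht')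
    have e : V 0 + ∫ s in (0:ℝ)..t, b s = V t := by linarith
    refine Eq.trans this ?_
    simp only [Pi.neg_apply, e, hAdef]
    ring
  refine ⟨?_, ?_⟩
  · exact hintg.congr_ae ((ae_restrict_iff' measurableSet_uIoc).2 hae)
  · rw [← intervalIntegral.integral_congr_ae hae, hftc]
    have hVt := hV T ⟨hT, le_rfl⟩
    have e : V 0 + ∫ s in (0:ℝ)..T, b s = V T := by linarith
    rw [e]
    simp [hAdef]

lemma aux_tendsto (g : ℝ → ℝ≥0∞) (u : ℕ → ℝ) (T : ℝ) (hu : Monotone u) (hlt : ∀ n, u n < T)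
    (hlim : Tendsto u atTop (𝓝 T)) :
    Tendsto (fun n => ∫⁻ s in Ioc 0 (u n), g s) atTop (𝓝 (∫⁻ s in Ioo 0 T, g s)) := by
  have hmono : Monotone fun n => Ioc 0 (u n) := fun i j hij => Ioc_subset_Ioc_right (hu hij)
  have hU : Ioo 0 T = ⋃ n, Ioc 0 (u n) := by
    ext s
    simp only [mem_Ioo, mem_iUnion, mem_Ioc]
    constructor
    · rintro ⟨h1, h2⟩
      obtain ⟨n, hn⟩ := (hlim.eventually (lt_mem_nhds h2)).exists
      exact ⟨n, h1, hn.le⟩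
    · rintro ⟨n, h1, h2⟩
      exact ⟨h1, h2.trans_lt (hlt n)⟩
  rw [hU, setLIntegral_iUnion_of_directed _ (directed_of_isDirected_le hmono)]
  exact tendsto_atTop_iSup fun i j hij => lintegral_mono_set (hmono hij)

lemma aux_bound (g : ℝ → ℝ≥0∞) (C : ℝ≥0∞) (h : ∀ n : ℕ, ∫⁻ s in Ioc (0:ℝ) n, g s ≤ C) :
    ∫⁻ s in Ioi 0, g s ≤ C := by
  have hmono : Monotone fun n : ℕ => Ioc (0:ℝ) n :=
    fun i j hij => Ioc_subset_Ioc_right (by exact_mod_cast hij)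
  have hU : Ioi (0:ℝ) = ⋃ n : ℕ, Ioc (0:ℝ) n := by
    ext s
    simp only [mem_Ioi, mem_iUnion, mem_Ioc]
    exact ⟨fun h => ⟨_, h, Nat.le_ceil s⟩, fun ⟨n, h, _⟩ => h⟩
  rw [hU, setLIntegral_iUnion_of_directed _ (directed_of_isDirected_le hmono)]
  exact iSup_le h

section
variable {n : ℕ} {U : Type*} [MeasurableSpace U] (S : Setting n U)

lemma aux_cont [TopologicalSpace U] (hS : Basic S) (x : Fin n → ℝ) : Continuous (S.φ x) :=
  hS.contFlow.comp (by fun_prop : Continuous fun t : ℝ => (x, t))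

lemma aux_memE [TopologicalSpace U] (hS : Basic S) (x : Fin n → ℝ) (hx : x ∈ S.E) (t : ℝ)
    (ht : t ∈ S.fs x) : S.φ x t ∈ S.E := by
  have hnf : ∀ s ∈ Icc 0 t, S.φ x s ∉ frontier S.E := by
    intro s hs hf
    rcases hs.1.eq_or_lt with h | h
    · rw [← h, hS.flowZero] at hf
      exact (Set.disjoint_left.1 (disjoint_frontier_iff_isOpen.2 hS.openE) hf) hx
    · have h1 : S.ts x ≤ ENNReal.ofReal s := sInf_le ⟨s, h, hf, rfl⟩
      have h2 : ENNReal.ofReal s ≤ ENNReal.ofReal t := ENNReal.ofReal_le_ofReal hs.2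
      exact absurd ht.2 (not_lt.2 (h1.trans h2))
  have hpre : IsPreconnected (S.φ x '' Icc 0 t) :=
    isPreconnected_Icc.image _ (aux_cont S hS x).continuousOn
  have := hpre.subset_left_of_subset_union (v := (closure S.E)ᶜ) hS.openE
    isClosed_closure.isOpen_compl
    (disjoint_compl_right.mono_left subset_closure) ?_ ?_
  · exact this ⟨t, ⟨ht.1, le_rfl⟩, rfl⟩
  · rintro _ ⟨s, hs, rfl⟩
    by_cases hc : S.φ x s ∈ closure S.E
    · left
      by_contra hne
      exact hnf s hs (by rw [hS.openE.frontier_eq]; exact ⟨hc, hne⟩)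
    · right; exact hc
  · exact ⟨x, ⟨0, ⟨le_rfl, ht.1⟩, hS.flowZero x⟩, hx⟩

lemma aux_frontier [TopologicalSpace U] (hS : Basic S) (x : Fin n → ℝ) (hx : x ∈ S.E)
    (ht : S.ts x < ⊤) : 0 < S.tsR x ∧ S.φ x (S.tsR x) ∈ frontier S.E := by
  have hne : {T : ℝ≥0∞ | ∃ t : ℝ, 0 < t ∧ S.φ x t ∈ frontier S.E ∧ T = ENNReal.ofReal t}.Nonempty := by
    by_contra h
    rw [not_nonempty_iff_eq_empty] at h
    rw [Setting.ts, h, sInf_empty] at ht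
    exact lt_irrefl _ ht
  obtain ⟨u, -, hu, hmem⟩ := exists_seq_tendsto_sInf hne (OrderBot.bddBelow _)
  choose t h0 hf he using hmem
  have hconv : Tendsto t atTop (𝓝 (S.tsR x)) := by
    have := (ENNReal.tendsto_toReal ht.ne).comp hu
    refine this.congr fun k => ?_
    simp [he, ENNReal.toReal_ofReal (h0 k).le]
  have hfr : S.φ x (S.tsR x) ∈ frontier S.E :=
    isClosed_frontier.mem_of_tendsto (((aux_cont S hS x).tendsto _).comp hconv)
      (Eventually.of_forall hf)
  refine ⟨lt_of_le_of_ne ENNReal.toReal_nonneg fun h => ?_, hfr⟩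
  rw [← h, hS.flowZero] at hfr
  exact (Set.disjoint_left.1 (disjoint_frontier_iff_isOpen.2 hS.openE) hfr) hx

lemma aux_lam_meas [TopologicalSpace U] (hS : Basic S) (x : Fin n → ℝ) (Θ : RControl U)
    (hΘ : S.IsRelaxed x Θ) : Measurable fun s => S.lamMix (S.φ x s) (Θ.time s) := by
  obtain ⟨h1, h2, -⟩ := hΘ
  let κ : ProbabilityTheory.Kernel ℝ U := ⟨Θ.time, h1⟩
  have : ProbabilityTheory.IsMarkovKernel κ := ⟨h2⟩
  have hm : Measurable (Function.uncurry fun (s : ℝ) (u : U) => ENNReal.ofReal (S.lam (S.φ x s) u)) := by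
    have hp : Measurable fun q : ℝ × U => (S.φ x q.1, q.2) :=
      ((aux_cont S hS x).measurable.comp measurable_fst).prodMk measurable_snd
    exact ENNReal.measurable_ofReal.comp (hS.lamMeas.comp hp)
  exact Measurable.lintegral_kernel_prod_right (κ := κ) hm

lemma aux_step [TopologicalSpace U] (hS : Basic S)
    (v Xv ℓ : (Fin n → ℝ) → ℝ) (k : (Fin n → ℝ) → ℝ≥0∞)
    (hv_mac : S.MemMac v Xv) (hv_nonneg : ∀ y ∈ S.E, 0 ≤ v y)
    (hl_nonneg : ∀ y ∈ S.E, 0 ≤ ℓ y)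
    (d α : ℝ) (hd : 0 ≤ d) (Θ : RControl U) (x : Fin n → ℝ) (hx : x ∈ S.E)
    (hΘ : S.IsRelaxed x Θ)
    (hLam_fin : ∀ t ∈ S.fs x, S.Lam x Θ t < ⊤)
    (hdiff : ∀ t ∈ S.fs x,
      ((Xv (S.φ x t) + ℓ (S.φ x t) : ℝ) : EReal)
          + ((S.lamQMix k (S.φ x t) (Θ.time t) : ℝ≥0∞) : EReal)
        ≤ ((d : ℝ) : EReal) + ((α * v (S.φ x t) : ℝ) : EReal)
          + ((S.lamMix (S.φ x t) (Θ.time t) * ENNReal.ofReal (v (S.φ x t)) : ℝ≥0∞) : EReal))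
    (T : ℝ) (hT : T ∈ S.fs x) :
    (∫⁻ t in Ioc 0 T, (S.weight α x Θ t * ENNReal.ofReal (ℓ (S.φ x t))
        + S.weight α x Θ t * S.lamQMix k (S.φ x t) (Θ.time t)))
      + S.weight α x Θ T * ENNReal.ofReal (v (S.φ x T))
      ≤ ENNReal.ofReal (v x) + ENNReal.ofReal d * S.curlyL α x Θ := by
  have hT0 : 0 ≤ T := hT.1
  have hsub : ∀ t ∈ Icc 0 T, t ∈ S.fs x := fun t ht =>
    ⟨ht.1, (ENNReal.ofReal_le_ofReal ht.2).trans_lt hT.2⟩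
  have hE : ∀ t ∈ Icc 0 T, S.φ x t ∈ S.E := fun t ht => aux_memE S hS x hx t (hsub t ht)
  have hlm := aux_lam_meas S hS x Θ hΘ
  set lamE : ℝ → ℝ≥0∞ := fun s => S.lamMix (S.φ x s) (Θ.time s) with hlamE
  set a : ℝ → ℝ := fun s => α + (lamE s).toReal with hadef
  set b : ℝ → ℝ := fun s => Xv (S.φ x s) with hbdef
  set V : ℝ → ℝ := fun s => v (S.φ x s) with hVdef
  set W : ℝ → ℝ := fun t => Real.exp (-∫ s in (0:ℝ)..t, a s) with hWdef
  have hfinT : ∫⁻ s in Ioc 0 T, lamE s < ⊤ := hLam_fin T hT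
  have hlamfin : ∀ᵐ t ∂(volume.restrict (Ioc 0 T)), lamE t < ⊤ := ae_lt_top hlm hfinT.ne
  have hintg : IntervalIntegrable (fun s => (lamE s).toReal) volume 0 T := by
    rw [intervalIntegrable_iff_integrableOn_Ioc_of_le hT0]
    exact integrable_toReal_of_lintegral_ne_top hlm.aemeasurable hfinT.ne
  have ha : IntervalIntegrable a volume 0 T := intervalIntegrable_const.add hintg
  have hb : IntervalIntegrable b volume 0 T := (hv_mac.2.2.1 x hx T hT).1
  have hV0 : V 0 = v x := by simp [hVdef, hS.flowZero]
  have hV : ∀ t ∈ Icc 0 T, V t - V 0 = ∫ s in (0:ℝ)..t, b s := by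
    intro t ht
    rw [hV0]
    exact (hv_mac.2.2.1 x hx t (hsub t ht)).2
  have hw : ∀ t ∈ Icc 0 T, S.weight α x Θ t = ENNReal.ofReal (W t) := by
    intro t ht
    have hf := hLam_fin t (hsub t ht)
    have hf' : ∀ᵐ s ∂(volume.restrict (Ioc 0 t)), lamE s < ⊤ := ae_lt_top hlm hf.ne
    have hi : IntervalIntegrable (fun s => (lamE s).toReal) volume 0 t :=
      hintg.mono_set (by
        rw [uIcc_of_le hT0, uIcc_of_le ht.1]; exact Icc_subset_Icc_right ht.2)
    have e : ∫ s in (0:ℝ)..t, a s = α * t + (S.Lam x Θ t).toReal := by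
      simp only [hadef]
      rw [intervalIntegral.integral_add intervalIntegrable_const hi,
        intervalIntegral.integral_const, intervalIntegral.integral_of_le ht.1,
        integral_toReal hlm.aemeasurable hf']
      simp [Setting.Lam, hlamE, mul_comm]
    rw [Setting.weight, if_neg hf.ne, hWdef]
    simp only [e]
    congr 2; ring
  obtain ⟨hDint, hDeq⟩ := aux_identity a b V T hT0 ha hb hV
  have hWc : ContinuousOn W (uIcc 0 T) :=
    (aux_ac_exp (ha.absolutelyContinuousOnInterval_intervalIntegral left_mem_uIcc)).continuousOn
  have hWint : IntervalIntegrable W volume 0 T := hWc.intervalIntegrable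
  have hWpos : ∀ t, 0 < W t := fun t => Real.exp_pos _
  have hpt : ∀ᵐ t ∂(volume.restrict (Ioc 0 T)),
      (S.weight α x Θ t * ENNReal.ofReal (ℓ (S.φ x t))
        + S.weight α x Θ t * S.lamQMix k (S.φ x t) (Θ.time t)
        ≤ ENNReal.ofReal (d * W t - W t * (b t - a t * V t))) ∧
      0 ≤ d * W t - W t * (b t - a t * V t) := by
    filter_upwards [hlamfin, ae_restrict_mem measurableSet_Ioc] with t hlt ht
    have htI : t ∈ Icc 0 T := ⟨ht.1.le, ht.2⟩
    have hd1 := hdiff t (hsub t htI)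
    have hv0 := hv_nonneg _ (hE t htI)
    have hl0 := hl_nonneg _ (hE t htI)
    have e1 : S.lamMix (S.φ x t) (Θ.time t) * ENNReal.ofReal (v (S.φ x t))
        = ENNReal.ofReal ((lamE t).toReal * V t) := by
      rw [ENNReal.ofReal_mul ENNReal.toReal_nonneg, ENNReal.ofReal_toReal hlt.ne]
    have hlV : 0 ≤ (lamE t).toReal * V t := mul_nonneg ENNReal.toReal_nonneg hv0
    rw [e1, EReal.coe_ennreal_ofReal, max_eq_left hlV] at hd1
    rw [hw t htI]
    generalize S.lamQMix k (S.φ x t) (Θ.time t) = q at hd1 ⊢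
    induction q with
    | top =>
      exfalso
      rw [EReal.coe_ennreal_top, EReal.coe_add_top, ← EReal.coe_add, ← EReal.coe_add] at hd1
      exact absurd (top_le_iff.1 hd1) (EReal.coe_ne_top _)
    | coe q =>
      have hd2 : Xv (S.φ x t) + ℓ (S.φ x t) + (q : ℝ)
          ≤ d + α * v (S.φ x t) + (lamE t).toReal * V t := by
        have : ((q : ℝ≥0∞) : EReal) = ((q : ℝ) : EReal) := rfl
        rw [this] at hd1
        exact_mod_cast hd1
      have hq : (q : ℝ≥0∞) = ENNReal.ofReal (q : ℝ) := by simp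
      have hmain : W t * (ℓ (S.φ x t) + q) ≤ d * W t - W t * (b t - a t * V t) := by
        have : W t * (ℓ (S.φ x t) + q) ≤ W t * (d - (b t - a t * V t)) := by
          apply mul_le_mul_of_nonneg_left _ (hWpos t).le
          simp only [hbdef, hadef, hVdef] at hd2 ⊢
          linarith
        linarith
      have hnn : 0 ≤ W t * (ℓ (S.φ x t) + q) :=
        mul_nonneg (hWpos t).le (add_nonneg hl0 q.2)
      refine ⟨?_, hnn.trans hmain⟩
      rw [hq, ← mul_add, ← ENNReal.ofReal_add hl0 (NNReal.coe_nonneg q), ← ENNReal.ofReal_mul (hWpos t).le]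
      exact ENNReal.ofReal_le_ofReal hmain
  have hIint : IntervalIntegrable (fun t => d * W t - W t * (b t - a t * V t)) volume 0 T :=
    (hWint.const_mul d).sub hDint
  have hInt2 := (intervalIntegrable_iff_integrableOn_Ioc_of_le hT0).1 hIint
  have hWI := (intervalIntegrable_iff_integrableOn_Ioc_of_le hT0).1 hWint
  have hle1 : (∫⁻ t in Ioc 0 T, (S.weight α x Θ t * ENNReal.ofReal (ℓ (S.φ x t))
        + S.weight α x Θ t * S.lamQMix k (S.φ x t) (Θ.time t)))
      ≤ ENNReal.ofReal (∫ t in (0:ℝ)..T, (d * W t - W t * (b t - a t * V t))) := by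
    rw [intervalIntegral.integral_of_le hT0,
      ofReal_integral_eq_lintegral_ofReal hInt2 (hpt.mono fun t h => h.2)]
    exact lintegral_mono_ae (hpt.mono fun t h => h.1)
  have hnn1 : 0 ≤ ∫ t in (0:ℝ)..T, (d * W t - W t * (b t - a t * V t)) := by
    rw [intervalIntegral.integral_of_le hT0]
    exact integral_nonneg_of_ae (hpt.mono fun t h => h.2)
  have hval : ∫ t in (0:ℝ)..T, (d * W t - W t * (b t - a t * V t))
      = d * (∫ t in (0:ℝ)..T, W t) - (W T * V T - V 0) := by
    rw [intervalIntegral.integral_sub (hWint.const_mul d) hDint, hDeq,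
      intervalIntegral.integral_const_mul]
  have hVT : 0 ≤ V T := hv_nonneg _ (hE T ⟨hT0, le_rfl⟩)
  have hVx : 0 ≤ v x := hv_nonneg x hx
  have hWI0 : 0 ≤ ∫ t in (0:ℝ)..T, W t :=
    intervalIntegral.integral_nonneg hT0 fun t _ => (hWpos t).le
  have hcurly : ENNReal.ofReal (∫ t in (0:ℝ)..T, W t) ≤ S.curlyL α x Θ := by
    rw [intervalIntegral.integral_of_le hT0,
      ofReal_integral_eq_lintegral_ofReal hWI (Eventually.of_forall fun t => (hWpos t).le)]
    calc ∫⁻ t in Ioc 0 T, ENNReal.ofReal (W t)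
        = ∫⁻ t in Ioc 0 T, S.weight α x Θ t :=
          setLIntegral_congr_fun measurableSet_Ioc fun t ht => (hw t ⟨ht.1.le, ht.2⟩).symm
      _ ≤ S.curlyL α x Θ :=
          lintegral_mono_set fun t ht => hsub t ⟨ht.1.le, ht.2⟩
  calc _ ≤ ENNReal.ofReal (∫ t in (0:ℝ)..T, (d * W t - W t * (b t - a t * V t)))
        + ENNReal.ofReal (W T * V T) := by
        rw [hw T ⟨hT0, le_rfl⟩, ENNReal.ofReal_mul (hWpos T).le]
        exact add_le_add hle1 le_rfl
    _ = ENNReal.ofReal (v x + d * ∫ t in (0:ℝ)..T, W t) := by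
        rw [← ENNReal.ofReal_add hnn1 (mul_nonneg (hWpos T).le hVT), hval, hV0]
        congr 1; ring
    _ = ENNReal.ofReal (v x) + ENNReal.ofReal d * ENNReal.ofReal (∫ t in (0:ℝ)..T, W t) := by
        rw [ENNReal.ofReal_add hVx (mul_nonneg hd hWI0), ENNReal.ofReal_mul hd]
    _ ≤ _ := by gcongr

end

/-- Proposition 3.1 of the paper: an integro-differential inequality along the flow implies the
inequality `v(x) + d·𝓛_α ≥ L_α ℓ + H_α p + G_α k` for the discrete-time operators. -/
theorem prop_3_1 {n : ℕ} {U : Type*} [MeasurableSpace U] [MetricSpace U] [CompactSpace U]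
    [BorelSpace U]
    (S : Setting n U) (hS : Basic S)
    (v Xv ℓ k p : (Fin n → ℝ) → ℝ)
    (hv_mac : S.MemMac v Xv) (hv_nonneg : ∀ y ∈ S.E, 0 ≤ v y)
    (hl_meas : Measurable ℓ) (hl_nonneg : ∀ y ∈ S.E, 0 ≤ ℓ y)
    (hk_meas : Measurable k) (hk_nonneg : ∀ y ∈ S.E, 0 ≤ k y)
    (hp_meas : Measurable p) (hp_nonneg : ∀ z ∈ frontier S.E, 0 ≤ p z)
    (d α : ℝ) (hd : 0 ≤ d)
    (Θ : (Fin n → ℝ) → RControl U) (hΘ : ∀ x ∈ S.E, S.IsRelaxed x (Θ x))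
    -- (i) finiteness of `Λ^{μ(x)}(x,t)` and of `𝓛_α(x,Θ(x))`
    (hLam_fin : ∀ x ∈ S.E, ∀ t ∈ S.fs x, S.Lam x (Θ x) t < ⊤)
    (hcurly_fin : ∀ x ∈ S.E, S.curlyL α x (Θ x) < ⊤)
    -- (ii) the integro-differential inequality
    -- `Xv - (α + λ(·,μ))v + ℓ + λQk ≤ d` along the flow
    (hdiff : ∀ x ∈ S.E, ∀ t ∈ S.fs x,
      ((Xv (S.φ x t) + ℓ (S.φ x t) : ℝ) : EReal)
          + ((S.lamQMix (fun z => ENNReal.ofReal (k z)) (S.φ x t) ((Θ x).time t) : ℝ≥0∞) :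
              EReal)
        ≤ ((d : ℝ) : EReal) + ((α * v (S.φ x t) : ℝ) : EReal)
          + ((S.lamMix (S.φ x t) ((Θ x).time t) * ENNReal.ofReal (v (S.φ x t)) : ℝ≥0∞) : EReal))
    -- (iii) the boundary inequality `v ≥ p + Qk` at `φ(x,t*(x))` when `t*(x) < ∞`
    (hbdry : ∀ x ∈ S.E, S.ts x < ⊤ →
      ((p (S.φ x (S.tsR x)) : ℝ) : EReal)
          + ((S.QMix (fun z => ENNReal.ofReal (k z)) (S.φ x (S.tsR x)) ((Θ x).bdry) : ℝ≥0∞) :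
              EReal)
        ≤ ((v (S.φ x (S.tsR x)) : ℝ) : EReal))
    (x : Fin n → ℝ) (hx : x ∈ S.E) :
    S.Lop α (fun y _ => ENNReal.ofReal (ℓ y)) x (Θ x)
        + S.Hop α (fun z _ => ENNReal.ofReal (p z)) x (Θ x)
        + S.Gop α (fun z => ENNReal.ofReal (k z)) x (Θ x)
      ≤ ENNReal.ofReal (v x) + ENNReal.ofReal d * S.curlyL α x (Θ x) := by
  have hstep := fun T hT => aux_step S hS v Xv ℓ (fun z => ENNReal.ofReal (k z)) hv_mac hv_nonneg
    hl_nonneg d α hd (Θ x) x hx (hΘ x hx) (hLam_fin x hx) (hdiff x hx) T hT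
  set C : ℝ≥0∞ := ENNReal.ofReal (v x) + ENNReal.ofReal d * S.curlyL α x (Θ x) with hC
  set g : ℝ → ℝ≥0∞ := fun t => S.weight α x (Θ x) t * ENNReal.ofReal (ℓ (S.φ x t))
    + S.weight α x (Θ x) t
      * S.lamQMix (fun z => ENNReal.ofReal (k z)) (S.φ x t) ((Θ x).time t) with hg
  -- measurability of the weight along the flow
  have hlm := aux_lam_meas S hS x (Θ x) (hΘ x hx)
  have hLmono : Monotone fun t => S.Lam x (Θ x) t := fun s t hst =>
    lintegral_mono_set (Ioc_subset_Ioc_right hst)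
  have hLmeas : Measurable fun t => S.Lam x (Θ x) t := hLmono.measurable
  have hwmeas : Measurable fun t => S.weight α x (Θ x) t := by
    unfold Setting.weight
    refine Measurable.ite (hLmeas (measurableSet_singleton ⊤)) measurable_const ?_
    exact ENNReal.measurable_ofReal.comp (Real.measurable_exp.comp
      (((measurable_const.mul measurable_id).neg).sub hLmeas.ennreal_toReal))
  have hlmeas : Measurable fun t => S.weight α x (Θ x) t * ENNReal.ofReal (ℓ (S.φ x t)) :=
    hwmeas.mul (ENNReal.measurable_ofReal.comp (hl_meas.comp (aux_cont S hS x).measurable))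
  have hsum : S.Lop α (fun y _ => ENNReal.ofReal (ℓ y)) x (Θ x)
      + S.Lop α (fun y m => S.lamQMix (fun z => ENNReal.ofReal (k z)) y m) x (Θ x)
      = ∫⁻ t in S.fs x, g t := by
    rw [Setting.Lop, Setting.Lop, ← lintegral_add_left hlmeas]
  rw [Setting.Gop]
  have hre : ∀ p q r s : ℝ≥0∞, p + q + (r + s) = (p + r) + (q + s) := fun p q r s => by ring
  rw [hre, hsum]
  by_cases hts : S.ts x < ⊤
  · obtain ⟨hpos, hfr⟩ := aux_frontier S hS x hx hts
    have hts_eq : ENNReal.ofReal (S.tsR x) = S.ts x := ENNReal.ofReal_toReal hts.ne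
    have hmem : ∀ t, t ∈ S.fs x ↔ 0 ≤ t ∧ t < S.tsR x := by
      intro t
      constructor
      · rintro ⟨h1, h2⟩
        rw [← hts_eq] at h2
        exact ⟨h1, (ENNReal.ofReal_lt_ofReal_iff hpos).1 h2⟩
      · rintro ⟨h1, h2⟩
        refine ⟨h1, ?_⟩
        rw [← hts_eq]
        exact (ENNReal.ofReal_lt_ofReal_iff hpos).2 h2
    have hfs : S.fs x = Ico 0 (S.tsR x) := by
      ext t; exact hmem t
    have hfsint : ∫⁻ t in S.fs x, g t = ∫⁻ t in Ioo 0 (S.tsR x), g t := by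
      rw [hfs]; exact (setLIntegral_congr Ioo_ae_eq_Ico).symm
    obtain ⟨u, humono, huI, hulim⟩ := exists_seq_strictMono_tendsto' hpos
    have hufs : ∀ j, u j ∈ S.fs x := fun j => (hmem _).2 ⟨(huI j).1.le, (huI j).2⟩
    have hlim1 := aux_tendsto g u (S.tsR x) humono.monotone (fun j => (huI j).2) hulim
    -- boundary term
    have hbd : S.Hop α (fun z _ => ENNReal.ofReal (p z)) x (Θ x)
        + S.Hop α (fun y m => S.QMix (fun z => ENNReal.ofReal (k z)) y m) x (Θ x)
        ≤ S.weight α x (Θ x) (S.tsR x) * ENNReal.ofReal (v (S.φ x (S.tsR x))) := by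
      rw [Setting.Hop, Setting.Hop, if_pos hts, if_pos hts, ← mul_add]
      gcongr
      have hb := hbdry x hx hts
      have hp0 := hp_nonneg _ hfr
      have hv' : ((v (S.φ x (S.tsR x)) : ℝ) : EReal)
          ≤ ((ENNReal.ofReal (v (S.φ x (S.tsR x))) : ℝ≥0∞) : EReal) := by
        rw [EReal.coe_ennreal_ofReal]
        exact EReal.coe_le_coe_iff.2 (le_max_left _ _)
      have hb2 := hb.trans hv'
      have hp' : ((p (S.φ x (S.tsR x)) : ℝ) : EReal)
          = ((ENNReal.ofReal (p (S.φ x (S.tsR x))) : ℝ≥0∞) : EReal) := by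
        rw [EReal.coe_ennreal_ofReal, max_eq_left hp0]
      rw [hp', ← EReal.coe_ennreal_add] at hb2
      exact EReal.coe_ennreal_le_coe_ennreal_iff.1 hb2
    refine (add_le_add le_rfl hbd).trans ?_
    rw [hfsint]
    by_cases hLtop : S.Lam x (Θ x) (S.tsR x) = ⊤
    · have hw0 : S.weight α x (Θ x) (S.tsR x) = 0 := by rw [Setting.weight, if_pos hLtop]
      rw [hw0, zero_mul, add_zero]
      exact le_of_tendsto' hlim1 fun j => le_self_add.trans (hstep (u j) (hufs j))
    · have hLlim : Tendsto (fun j => S.Lam x (Θ x) (u j)) atTop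
          (𝓝 (S.Lam x (Θ x) (S.tsR x))) := by
        have := aux_tendsto (fun s => S.lamMix (S.φ x s) ((Θ x).time s)) u (S.tsR x)
          humono.monotone (fun j => (huI j).2) hulim
        rwa [setLIntegral_congr Ioo_ae_eq_Ioc] at this
      have hwlim : Tendsto (fun j => S.weight α x (Θ x) (u j)) atTop
          (𝓝 (S.weight α x (Θ x) (S.tsR x))) := by
        have h1 : ∀ j, S.weight α x (Θ x) (u j) = ENNReal.ofReal
            (Real.exp (-(α * u j) - (S.Lam x (Θ x) (u j)).toReal)) := fun j => by
          rw [Setting.weight, if_neg (hLam_fin x hx _ (hufs j)).ne]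
        simp only [h1]
        rw [Setting.weight, if_neg hLtop]
        refine ENNReal.tendsto_ofReal ((Real.continuous_exp.tendsto _).comp ?_)
        exact ((hulim.const_mul α).neg).sub ((ENNReal.tendsto_toReal hLtop).comp hLlim)
      have hwfin : S.weight α x (Θ x) (S.tsR x) ≠ ⊤ := by
        rw [Setting.weight, if_neg hLtop]; exact ENNReal.ofReal_ne_top
      have hvlim : Tendsto (fun j => ENNReal.ofReal (v (S.φ x (u j)))) atTop
          (𝓝 (ENNReal.ofReal (v (S.φ x (S.tsR x))))) := by
        refine ENNReal.tendsto_ofReal ((hv_mac.2.2.2 x hx hts).comp ?_)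
        exact tendsto_nhdsWithin_iff.2 ⟨hulim, Eventually.of_forall fun j => (huI j).2⟩
      have hlim2 := ENNReal.Tendsto.mul hwlim (Or.inr ENNReal.ofReal_ne_top) hvlim
        (Or.inr hwfin)
      exact le_of_tendsto' (hlim1.add hlim2) fun j => hstep (u j) (hufs j)
  · have htop : S.ts x = ⊤ := not_lt_top_iff.1 hts
    rw [Setting.Hop, Setting.Hop, if_neg hts, if_neg hts, add_zero, add_zero]
    have hmem : ∀ t : ℝ, 0 ≤ t → t ∈ S.fs x := fun t ht =>
      ⟨ht, by rw [htop]; exact ENNReal.ofReal_lt_top⟩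
    have hfs : S.fs x = Ici 0 := by
      ext t; exact ⟨fun h => h.1, fun h => hmem t h⟩
    rw [hfs, ← setLIntegral_congr Ioi_ae_eq_Ici]
    exact aux_bound g C fun j => le_self_add.trans (hstep j (hmem _ (Nat.cast_nonneg j)))
end

section
/- Suppose there are v ∈ M^ac(E) with v ≥ 0, a measurable g : E → [1,∞) with v ∈ B_g(E), measurable λ̲ : E → [0,∞) with λ(y,a) ≥ λ̲(y) for all y ∈ E and a ∈ 𝕌(y), measurable ℓ, k : E → [0,∞), measurable p : ∂E → [0,∞), a constant d ≥ 0, α ≥ 0, and for each x ∈ E a relaxed control Θ(x) = (μ(x), μ∂(x)) ∈ V^r(x) such that: (i) Λ^{μ(x)}(x,t) < ∞ and 𝓛_α(x,Θ(x)) < ∞ for all x ∈ E and t ∈ [0,t*(x)); (ii) for all x ∈ E and t ∈ [0,t*(x)): Xv(φ(x,t)) − [α + λ(φ(x,t),μ(x,t))]·v(φ(x,t)) + ℓ(φ(x,t)) + λQk(φ(x,t),μ(x,t)) = d; (iii) for all x ∈ E with t*(x) < ∞: v(φ(x,t*(x))) = p(φ(x,t*(x))) + Qk(φ(x,t*(x)),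 μ∂(x)); (iv) for every x ∈ E with t*(x) = ∞: e^{−∫_0^t λ̲(φ(x,s))ds}·g(φ(x,t)) → 0 as t → ∞. Then for every x ∈ E (with all terms valued in [0,∞]): v(x) + d·𝓛_α(x,Θ(x)) = L_α ℓ(x,Θ(x)) + H_α p(x,Θ(x)) + G_α k(x,Θ(x)). -/
open MeasureTheory ENNReal Set Filter Topology

open PDMP MeasureTheory ENNReal Set Filter Topology

namespace Aux32

lemma exp_neg_dist {a b : ℝ} (ha : 0 ≤ a) (hb : 0 ≤ b) :
    dist (Real.exp (-a)) (Real.exp (-b)) ≤ dist a b := by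
  wlog hab : a ≤ b generalizing a b
  · rw [dist_comm, dist_comm a b]; exact this hb ha (le_of_not_ge hab)
  have h1 : Real.exp (-b) ≤ Real.exp (-a) := Real.exp_le_exp.2 (by linarith)
  rw [Real.dist_eq, Real.dist_eq, abs_of_nonneg (by linarith), abs_of_nonpos (by linarith)]
  have h2 : Real.exp (-b) = Real.exp (-a) * Real.exp (a - b) := by
    rw [← Real.exp_add]; ring_nf
  have h3 : a - b + 1 ≤ Real.exp (a - b) := Real.add_one_le_exp _
  have h4 : Real.exp (-a) ≤ 1 := Real.exp_le_one_iff.2 (by linarith)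
  have h5 := Real.exp_pos (-a)
  nlinarith

lemma ac_exp {F : ℝ → ℝ} {T : ℝ} (hT : 0 ≤ T) (hF : AbsolutelyContinuousOnInterval F 0 T)
    (h0 : ∀ t ∈ Icc 0 T, 0 ≤ F t) :
    AbsolutelyContinuousOnInterval (fun t => Real.exp (-F t)) 0 T := by
  rw [absolutelyContinuousOnInterval_iff] at hF ⊢
  intro ε hε
  obtain ⟨δ, hδ, h⟩ := hF ε hε
  refine ⟨δ, hδ, fun E hE hs => lt_of_le_of_lt (Finset.sum_le_sum fun i hi => ?_) (h E hE hs)⟩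
  have := hE.1 i hi
  rw [uIcc_of_le hT] at this
  exact exp_neg_dist (h0 _ this.1) (h0 _ this.2)

lemma ibp {r D : ℝ → ℝ} {T V0 : ℝ} (hT : 0 ≤ T) (hr : IntervalIntegrable r volume 0 T)
    (hD : IntervalIntegrable D volume 0 T) (hr0 : ∀ t ∈ Icc 0 T, 0 ≤ r t) :
    IntervalIntegrable (fun t => Real.exp (-∫ s in (0:ℝ)..t, r s) *
        (r t * (V0 + ∫ s in (0:ℝ)..t, D s) - D t)) volume 0 T ∧
    IntervalIntegrable (fun t => Real.exp (-∫ s in (0:ℝ)..t, r s)) volume 0 T ∧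
    ∫ t in (0:ℝ)..T, Real.exp (-∫ s in (0:ℝ)..t, r s) *
        (r t * (V0 + ∫ s in (0:ℝ)..t, D s) - D t) =
      V0 - Real.exp (-∫ s in (0:ℝ)..T, r s) * (V0 + ∫ s in (0:ℝ)..T, D s) := by
  have hF := hr.absolutelyContinuousOnInterval_intervalIntegral (c := 0) (by simp)
  have hW := ac_exp hT hF (fun t ht => intervalIntegral.integral_nonneg ht.1
    (fun s hs => hr0 s ⟨hs.1, hs.2.trans ht.2⟩))
  have hG := hD.absolutelyContinuousOnInterval_intervalIntegral (c := 0) (by simp)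
  have hc : AbsolutelyContinuousOnInterval (fun _ : ℝ => V0) 0 T :=
    ContDiffOn.absolutelyContinuousOnInterval contDiffOn_const
  have hV : AbsolutelyContinuousOnInterval (fun t => V0 + ∫ s in (0:ℝ)..t, D s) 0 T := hc.add hG
  refine ⟨?_, hW.continuousOn.intervalIntegrable, ?_⟩
  · exact ((hr.mul_continuousOn hV.continuousOn).sub hD).continuousOn_mul hW.continuousOn
  · have key := AbsolutelyContinuousOnInterval.integral_deriv_mul_eq_sub hW hV
    simp only [intervalIntegral.integral_same, neg_zero, Real.exp_zero, add_zero, one_mul] at key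
    rw [show V0 - Real.exp (-∫ s in (0:ℝ)..T, r s) * (V0 + ∫ s in (0:ℝ)..T, D s) =
      -(Real.exp (-∫ s in (0:ℝ)..T, r s) * (V0 + ∫ s in (0:ℝ)..T, D s) - V0) by ring, ← key,
      ← intervalIntegral.integral_neg]
    apply intervalIntegral.integral_congr_ae
    filter_upwards [hr.ae_hasDerivAt_integral, hD.ae_hasDerivAt_integral] with t h1 h2 ht
    have ht' := uIoc_subset_uIcc ht
    have e1 := (h1 ht' 0 (by simp)).neg.exp.deriv
    have e2 := ((h2 ht' 0 (by simp)).const_add V0).deriv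
    simp only [Pi.neg_apply] at e1
    erw [e1, e2]
    ring

/-- The finite-horizon identity in `ℝ≥0∞`. -/
lemma ibp_lintegral {r D V : ℝ → ℝ} {T d : ℝ} (hT : 0 ≤ T)
    (hr : IntervalIntegrable r volume 0 T)
    (hD : IntervalIntegrable D volume 0 T) (hr0 : ∀ t ∈ Icc 0 T, 0 ≤ r t)
    (hV : ∀ t ∈ Icc 0 T, V t = V 0 + ∫ s in (0:ℝ)..t, D s)
    (hV0 : ∀ t ∈ Icc 0 T, 0 ≤ V t) (hd : 0 ≤ d)
    (hpos : ∀ᵐ t ∂(volume.restrict (Ioc 0 T)), 0 ≤ d + r t * V t - D t) :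
    (∫⁻ t in Ioc 0 T, ENNReal.ofReal (Real.exp (-∫ s in (0:ℝ)..t, r s) * (d + r t * V t - D t)))
      + ENNReal.ofReal (Real.exp (-∫ s in (0:ℝ)..T, r s) * V T)
    = ENNReal.ofReal (V 0) + ENNReal.ofReal d *
        ∫⁻ t in Ioc 0 T, ENNReal.ofReal (Real.exp (-∫ s in (0:ℝ)..t, r s)) := by
  obtain ⟨h1, h2, h3⟩ := ibp (V0 := V 0) hT hr hD hr0
  have h2d := h2.const_mul d
  set W : ℝ → ℝ := fun t => Real.exp (-∫ s in (0:ℝ)..t, r s) with hW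
  have hWp : ∀ t, 0 ≤ W t := fun t => (Real.exp_pos _).le
  have heq : ∀ t ∈ Icc 0 T, W t * (d + r t * V t - D t) =
      d * W t + W t * (r t * (V 0 + ∫ s in (0:ℝ)..t, D s) - D t) := by
    intro t ht
    rw [← hV t ht]; ring
  have hsum := h2d.add h1
  have hint : IntervalIntegrable (fun t => W t * (d + r t * V t - D t)) volume 0 T := by
    refine hsum.congr fun t ht => ?_
    rw [uIoc_of_le hT] at ht
    exact (heq t (Ioc_subset_Icc_self ht)).symm
  have hval : ∫ t in (0:ℝ)..T, W t * (d + r t * V t - D t) =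
      d * (∫ t in (0:ℝ)..T, W t) + (V 0 - W T * V T) := by
    rw [hV T ⟨hT, le_rfl⟩, ← h3, ← intervalIntegral.integral_const_mul,
      ← intervalIntegral.integral_add h2d h1]
    apply intervalIntegral.integral_congr
    intro t ht
    rw [uIcc_of_le hT] at ht
    exact heq t ht
  have a1 := ofReal_integral_eq_lintegral_ofReal
    ((intervalIntegrable_iff_integrableOn_Ioc_of_le hT).1 hint)
    (by filter_upwards [hpos] with t ht using mul_nonneg (hWp t) ht)
  have a2 := ofReal_integral_eq_lintegral_ofReal
    ((intervalIntegrable_iff_integrableOn_Ioc_of_le hT).1 h2)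
    (Eventually.of_forall hWp)
  have hI2 : 0 ≤ ∫ t in Ioc 0 T, W t := integral_nonneg hWp
  have hI1 : 0 ≤ ∫ t in Ioc 0 T, W t * (d + r t * V t - D t) :=
    integral_nonneg_of_ae (by filter_upwards [hpos] with t ht using mul_nonneg (hWp t) ht)
  rw [intervalIntegral.integral_of_le hT, intervalIntegral.integral_of_le hT] at hval
  change (∫⁻ t in Ioc 0 T, ENNReal.ofReal (W t * (d + r t * V t - D t)))
      + ENNReal.ofReal (W T * V T)
    = ENNReal.ofReal (V 0) + ENNReal.ofReal d * ∫⁻ t in Ioc 0 T, ENNReal.ofReal (W t)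
  rw [← a1, ← a2, ← ENNReal.ofReal_mul hd,
    ← ENNReal.ofReal_add hI1 (mul_nonneg (hWp _) (hV0 T ⟨hT, le_rfl⟩)),
    ← ENNReal.ofReal_add (hV0 0 ⟨le_rfl, hT⟩) (mul_nonneg hd hI2), hval]
  ring_nf

section
variable {n : ℕ} {U : Type*} [MeasurableSpace U] (S : Setting n U)

lemma fs_mono {x : Fin n → ℝ} {s t : ℝ} (ht : t ∈ S.fs x) (hs : 0 ≤ s) (hst : s ≤ t) :
    s ∈ S.fs x := ⟨hs, (ENNReal.ofReal_le_ofReal hst).trans_lt ht.2⟩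

lemma cont_flow [TopologicalSpace U] (hS : Basic S) (x : Fin n → ℝ) : Continuous (S.φ x) :=
  hS.contFlow.comp (Continuous.prodMk continuous_const continuous_id)

lemma inE [TopologicalSpace U] (hS : Basic S) {x : Fin n → ℝ} (hx : x ∈ S.E) {t : ℝ}
    (ht : t ∈ S.fs x) : S.φ x t ∈ S.E := by
  by_contra hn
  have hpre : IsPreconnected (S.φ x '' Icc 0 t) :=
    isPreconnected_Icc.image _ (cont_flow S hS x).continuousOn
  have hex : ∃ s ∈ Icc 0 t, S.φ x s ∈ frontier S.E := by
    by_contra hno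
    push Not at hno
    have hcl : ∀ s ∈ Icc 0 t, S.φ x s ∉ S.E → S.φ x s ∉ closure S.E := by
      intro s hs h1 h2
      apply hno s hs
      rw [hS.openE.frontier_eq]
      exact ⟨h2, h1⟩
    obtain ⟨z, -, h1, h2⟩ := hpre S.E (closure S.E)ᶜ hS.openE isClosed_closure.isOpen_compl
      (by
        rintro _ ⟨s, hs, rfl⟩
        by_cases h : S.φ x s ∈ S.E
        · exact Or.inl h
        · exact Or.inr (hcl s hs h))
      ⟨x, ⟨0, ⟨le_rfl, ht.1⟩, hS.flowZero x⟩, hx⟩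
      ⟨_, ⟨t, ⟨ht.1, le_rfl⟩, rfl⟩, hcl t ⟨ht.1, le_rfl⟩ hn⟩
    exact h2 (subset_closure h1)
  obtain ⟨s, hs, hz⟩ := hex
  have hs0 : 0 < s := by
    rcases hs.1.lt_or_eq with h | h
    · exact h
    · exfalso
      rw [← h, hS.flowZero, hS.openE.frontier_eq] at hz
      exact hz.2 hx
  have h1 : S.ts x ≤ ENNReal.ofReal s := sInf_le ⟨s, hs0, hz, rfl⟩
  exact absurd (h1.trans (ENNReal.ofReal_le_ofReal hs.2)) (not_le.2 ht.2)

lemma frontier_ts [TopologicalSpace U] (hS : Basic S) {x : Fin n → ℝ} (hts : S.ts x < ⊤) :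
    S.φ x (S.tsR x) ∈ frontier S.E := by
  have hne : {T : ℝ≥0∞ | ∃ t : ℝ, 0 < t ∧ S.φ x t ∈ frontier S.E ∧
      T = ENNReal.ofReal t}.Nonempty := by
    by_contra h
    rw [not_nonempty_iff_eq_empty] at h
    rw [Setting.ts, h, sInf_empty] at hts
    exact lt_irrefl _ hts
  obtain ⟨u, -, hu, hm⟩ := exists_seq_tendsto_sInf hne (OrderBot.bddBelow _)
  have h2 : Tendsto (fun i => (u i).toReal) atTop (𝓝 (S.tsR x)) :=
    (ENNReal.tendsto_toReal hts.ne).comp hu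
  refine isClosed_frontier.mem_of_tendsto (((cont_flow S hS x).tendsto _).comp h2)
    (Eventually.of_forall fun i => ?_)
  obtain ⟨t, ht, hf, he⟩ := hm i
  simp only [Function.comp_apply, he, ENNReal.toReal_ofReal ht.le]
  exact hf

lemma tsR_pos [TopologicalSpace U] (hS : Basic S) {x : Fin n → ℝ} (hx : x ∈ S.E)
    (hts : S.ts x < ⊤) : 0 < S.tsR x := by
  rcases (ENNReal.toReal_nonneg (a := S.ts x)).lt_or_eq with h | h
  · exact h
  · have := frontier_ts S hS hts
    rw [Setting.tsR, ← h, hS.flowZero, hS.openE.frontier_eq] at this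
    exact absurd hx this.2

lemma Lam_mono (x : Fin n → ℝ) (Θ : RControl U) : Monotone (S.Lam x Θ) := fun _ _ h =>
  lintegral_mono_set (Ioc_subset_Ioc_right h)

lemma weight_meas (α : ℝ) (x : Fin n → ℝ) (Θ : RControl U) : Measurable (S.weight α x Θ) := by
  have hL := (Lam_mono S x Θ).measurable
  unfold Setting.weight
  refine Measurable.ite (hL (measurableSet_singleton ⊤)) measurable_const ?_
  have := hL.ennreal_toReal
  fun_prop

/-- Measurability of `s ↦ λ(φ(x,s), μ(s))`. -/
lemma lamMix_meas [TopologicalSpace U] (hS : Basic S) (x : Fin n → ℝ) (Θ : RControl U)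
    (hΘ : S.IsRelaxed x Θ) : Measurable fun s => S.lamMix (S.φ x s) (Θ.time s) := by
  let κ : ProbabilityTheory.Kernel ℝ U := ⟨Θ.time, hΘ.1⟩
  have : ProbabilityTheory.IsMarkovKernel κ := ⟨hΘ.2.1⟩
  have hf : Measurable (Function.uncurry fun (s : ℝ) (u : U) =>
      ENNReal.ofReal (S.lam (S.φ x s) u)) := by
    apply ENNReal.measurable_ofReal.comp
    exact hS.lamMeas.comp
      (((cont_flow S hS x).measurable.comp measurable_fst).prodMk measurable_snd)
  exact hf.lintegral_kernel_prod_right (κ := κ)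

/-- Passage to the limit along an increasing exhaustion of `[0,t*)`. -/
lemma limit_pass {s : Set ℝ} (T : ℕ → ℝ) (hT : Monotone T) (hU : s = ⋃ i, Icc 0 (T i))
    (F w b : ℝ → ℝ≥0∞) (bl a : ℝ≥0∞) (d : ℝ)
    (h : ∀ i, (∫⁻ t in Ioc 0 (T i), F t) + b (T i) = a + ENNReal.ofReal d * ∫⁻ t in Ioc 0 (T i), w t)
    (hb : Tendsto (fun i => b (T i)) atTop (𝓝 bl)) :
    (∫⁻ t in s, F t) + bl = a + ENNReal.ofReal d * ∫⁻ t in s, w t := by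
  have key : ∀ f : ℝ → ℝ≥0∞,
      Tendsto (fun i => ∫⁻ t in Ioc 0 (T i), f t) atTop (𝓝 (∫⁻ t in s, f t)) := by
    intro f
    have hm : Monotone fun i => Icc 0 (T i) := fun i j hij => Icc_subset_Icc_right (hT hij)
    rw [hU, setLIntegral_iUnion_of_directed _ hm.directed_le]
    simp_rw [restrict_Ioc_eq_restrict_Icc]
    exact tendsto_atTop_iSup fun i j hij => lintegral_mono_set (hm hij)
  refine tendsto_nhds_unique ((key F).add hb) ?_
  simp_rw [h]
  exact tendsto_const_nhds.add (ENNReal.Tendsto.const_mul (key w) (Or.inr ENNReal.ofReal_ne_top))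

lemma ereal_aux {a b c w : ℝ} {q m : ℝ≥0∞} (hw : 0 ≤ w) (hm : m ≠ ⊤)
    (h : ((a : ℝ) : EReal) + (q : EReal) = ((b : ℝ) : EReal) + ((c : ℝ) : EReal)
      + ((m * ENNReal.ofReal w : ℝ≥0∞) : EReal)) :
    q ≠ ⊤ ∧ a + q.toReal = b + c + m.toReal * w := by
  have h1 : ((m * ENNReal.ofReal w : ℝ≥0∞) : EReal) = ((m.toReal * w : ℝ) : EReal) := by
    rw [← EReal.coe_ennreal_toReal (ENNReal.mul_ne_top hm ENNReal.ofReal_ne_top),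
      ENNReal.toReal_mul, ENNReal.toReal_ofReal hw]
  rw [h1, ← EReal.coe_add, ← EReal.coe_add] at h
  have hq : q ≠ ⊤ := by
    rintro rfl
    rw [EReal.coe_ennreal_top, EReal.coe_add_top] at h
    exact EReal.coe_ne_top _ h.symm
  refine ⟨hq, ?_⟩
  rw [← EReal.coe_ennreal_toReal hq, ← EReal.coe_add] at h
  exact_mod_cast h

lemma lam_facts [TopologicalSpace U] (hS : Basic S) {x : Fin n → ℝ} (Θ : RControl U)
    (hΘ : S.IsRelaxed x Θ) {T : ℝ} (hT : 0 ≤ T) (hfin : S.Lam x Θ T < ⊤) :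
    (∀ᵐ s ∂(volume.restrict (Ioc 0 T)), S.lamMix (S.φ x s) (Θ.time s) < ⊤) ∧
    IntervalIntegrable (fun s => (S.lamMix (S.φ x s) (Θ.time s)).toReal) volume 0 T ∧
    ∫ s in (0:ℝ)..T, (S.lamMix (S.φ x s) (Θ.time s)).toReal = (S.Lam x Θ T).toReal := by
  have hm := lamMix_meas S hS x Θ hΘ
  have hae : ∀ᵐ s ∂(volume.restrict (Ioc 0 T)), S.lamMix (S.φ x s) (Θ.time s) < ⊤ :=
    ae_lt_top hm hfin.ne
  refine ⟨hae, ?_, ?_⟩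
  · rw [intervalIntegrable_iff_integrableOn_Ioc_of_le hT]
    exact integrable_toReal_of_lintegral_ne_top hm.aemeasurable hfin.ne
  · rw [intervalIntegral.integral_of_le hT, integral_toReal hm.aemeasurable hae]
    rfl

lemma finite_horizon [TopologicalSpace U] (hS : Basic S) {v Xv ℓ : (Fin n → ℝ) → ℝ}
    {q : (Fin n → ℝ) → Measure U → ℝ≥0∞}
    (hv_mac : S.MemMac v Xv) (hv_nonneg : ∀ y ∈ S.E, 0 ≤ v y)
    (hl_nonneg : ∀ y ∈ S.E, 0 ≤ ℓ y) (d α : ℝ) (hd : 0 ≤ d) (hα : 0 ≤ α)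
    {x : Fin n → ℝ} (hx : x ∈ S.E) (Θ : RControl U) (hΘ : S.IsRelaxed x Θ)
    (hLam_fin : ∀ t ∈ S.fs x, S.Lam x Θ t < ⊤)
    (hdiff : ∀ t ∈ S.fs x,
      ((Xv (S.φ x t) + ℓ (S.φ x t) : ℝ) : EReal) + (q (S.φ x t) (Θ.time t) : EReal)
        = ((d : ℝ) : EReal) + ((α * v (S.φ x t) : ℝ) : EReal)
          + ((S.lamMix (S.φ x t) (Θ.time t) * ENNReal.ofReal (v (S.φ x t)) : ℝ≥0∞) : EReal))
    {T : ℝ} (hT : T ∈ S.fs x) :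
    (∫⁻ t in Ioc 0 T, S.weight α x Θ t *
        (ENNReal.ofReal (ℓ (S.φ x t)) + q (S.φ x t) (Θ.time t)))
      + S.weight α x Θ T * ENNReal.ofReal (v (S.φ x T))
    = ENNReal.ofReal (v x) + ENNReal.ofReal d * ∫⁻ t in Ioc 0 T, S.weight α x Θ t := by
  have hT0 := hT.1
  obtain ⟨hae, hint, -⟩ := lam_facts S hS Θ hΘ hT0 (hLam_fin T hT)
  set L : ℝ → ℝ := fun s => (S.lamMix (S.φ x s) (Θ.time s)).toReal with hL
  have hfs : ∀ t ∈ Icc 0 T, t ∈ S.fs x := fun t ht => fs_mono S hT ht.1 ht.2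
  have hw : ∀ t ∈ Icc 0 T, S.weight α x Θ t =
      ENNReal.ofReal (Real.exp (-∫ s in (0:ℝ)..t, (α + L s))) := by
    intro t ht
    have hf := hLam_fin t (hfs t ht)
    obtain ⟨-, hi, he⟩ := lam_facts S hS Θ hΘ ht.1 hf
    rw [intervalIntegral.integral_add intervalIntegrable_const hi, he, Setting.weight, if_neg hf.ne,
      intervalIntegral.integral_const]
    simp only [sub_zero, smul_eq_mul]
    ring_nf
  have hVnn : ∀ t ∈ Icc 0 T, 0 ≤ v (S.φ x t) := fun t ht => hv_nonneg _ (inE S hS hx (hfs t ht))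
  have hae2 : ∀ᵐ t ∂(volume.restrict (Ioc 0 T)),
      q (S.φ x t) (Θ.time t) ≠ ⊤ ∧ ℓ (S.φ x t) + (q (S.φ x t) (Θ.time t)).toReal =
        d + (α + L t) * v (S.φ x t) - Xv (S.φ x t) := by
    filter_upwards [hae, ae_restrict_mem measurableSet_Ioc] with t ht htm
    have htm' := Ioc_subset_Icc_self htm
    obtain ⟨h1, h2⟩ := ereal_aux (hVnn t htm') ht.ne (hdiff t (hfs t htm'))
    refine ⟨h1, ?_⟩
    simp only [hL]
    linarith
  have hln : ∀ t ∈ Ioc 0 T, 0 ≤ ℓ (S.φ x t) := fun t ht =>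
    hl_nonneg _ (inE S hS hx (hfs t (Ioc_subset_Icc_self ht)))
  have main := ibp_lintegral (r := fun s => α + L s) (D := fun s => Xv (S.φ x s))
    (V := fun s => v (S.φ x s)) (d := d) hT0 (intervalIntegrable_const.add hint)
    (hv_mac.2.2.1 x hx T hT).1
    (fun t _ => add_nonneg hα ENNReal.toReal_nonneg)
    (fun t ht => by
      have := (hv_mac.2.2.1 x hx t (hfs t ht)).2
      simp only [hS.flowZero]
      linarith) hVnn hd
    (by
      filter_upwards [hae2, ae_restrict_mem measurableSet_Ioc] with t ht htm
      rw [← ht.2]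
      exact add_nonneg (hln t htm) ENNReal.toReal_nonneg)
  simp only [hS.flowZero] at main
  have c1 : (∫⁻ t in Ioc 0 T, S.weight α x Θ t) =
      ∫⁻ t in Ioc 0 T, ENNReal.ofReal (Real.exp (-∫ s in (0:ℝ)..t, (α + L s))) :=
    setLIntegral_congr_fun measurableSet_Ioc fun t ht => hw t (Ioc_subset_Icc_self ht)
  have c2 : (∫⁻ t in Ioc 0 T, S.weight α x Θ t *
        (ENNReal.ofReal (ℓ (S.φ x t)) + q (S.φ x t) (Θ.time t))) =
      ∫⁻ t in Ioc 0 T, ENNReal.ofReal (Real.exp (-∫ s in (0:ℝ)..t, (α + L s)) *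
        (d + (α + L t) * v (S.φ x t) - Xv (S.φ x t))) := by
    apply lintegral_congr_ae
    filter_upwards [hae2, ae_restrict_mem measurableSet_Ioc] with t ht htm
    rw [hw t (Ioc_subset_Icc_self htm), ← ht.2, ENNReal.ofReal_mul (Real.exp_pos _).le,
      ENNReal.ofReal_add (hln t htm) ENNReal.toReal_nonneg, ENNReal.ofReal_toReal ht.1]
  rw [c1, c2, hw T ⟨hT0, le_rfl⟩, ← ENNReal.ofReal_mul (Real.exp_pos _).le]
  exact main

/-- Left continuity of the weight along an increasing sequence. -/
lemma weight_tendsto (α : ℝ) (x : Fin n → ℝ) (Θ : RControl U) {a : ℝ} (T : ℕ → ℝ)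
    (hT : StrictMono T) (hTa : ∀ i, T i < a) (hTl : Tendsto T atTop (𝓝 a))
    (hfin : ∀ i, S.Lam x Θ (T i) < ⊤) :
    Tendsto (fun i => S.weight α x Θ (T i)) atTop (𝓝 (S.weight α x Θ a)) := by
  have hL : Tendsto (fun i => S.Lam x Θ (T i)) atTop (𝓝 (S.Lam x Θ a)) := by
    have hm : Monotone fun i => Ioc 0 (T i) :=
      fun i j hij => Ioc_subset_Ioc_right (hT.monotone hij)
    have hU : Ioo 0 a = ⋃ i, Ioc 0 (T i) := by
      ext t
      simp only [mem_Ioo, mem_iUnion, mem_Ioc]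
      constructor
      · rintro ⟨h1, h2⟩
        obtain ⟨i, hi⟩ := (hTl.eventually (lt_mem_nhds h2)).exists
        exact ⟨i, h1, hi.le⟩
      · rintro ⟨i, h1, h2⟩
        exact ⟨h1, h2.trans_lt (hTa i)⟩
    have : S.Lam x Θ a = ⨆ i, S.Lam x Θ (T i) := by
      simp only [Setting.Lam]
      rw [← setLIntegral_iUnion_of_directed _ hm.directed_le, ← hU, restrict_Ioo_eq_restrict_Ioc]
    rw [this]
    exact tendsto_atTop_iSup fun i j hij => Lam_mono S x Θ (hT.monotone hij)
  have hwi : ∀ i, S.weight α x Θ (T i) =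
      ENNReal.ofReal (Real.exp (-(α * T i) - (S.Lam x Θ (T i)).toReal)) :=
    fun i => if_neg (hfin i).ne
  simp_rw [hwi]
  by_cases hLa : S.Lam x Θ a = ⊤
  · rw [Setting.weight, if_pos hLa, ← ENNReal.ofReal_zero]
    refine ENNReal.tendsto_ofReal (Real.tendsto_exp_atBot.comp ?_)
    rw [hLa] at hL
    have h1 : Tendsto (fun i => (S.Lam x Θ (T i)).toReal) atTop atTop := by
      rw [tendsto_atTop]
      intro b
      filter_upwards [hL.eventually (lt_mem_nhds (ENNReal.ofReal_lt_top (r := b)))] with i hi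
      exact (ENNReal.ofReal_le_iff_le_toReal (hfin i).ne).1 hi.le
    have h2 : Tendsto (fun i => -(α * T i)) atTop (𝓝 (-(α * a))) := (hTl.const_mul α).neg
    simp_rw [sub_eq_add_neg]
    exact h2.add_atBot (tendsto_neg_atTop_atBot.comp h1)
  · rw [Setting.weight, if_neg hLa]
    refine ENNReal.tendsto_ofReal ((Real.continuous_exp.tendsto _).comp ?_)
    exact (hTl.const_mul α).neg.sub ((ENNReal.tendsto_toReal hLa).comp hL)

/-- `∫ λ̲ ≤ Λ`. -/
lemma lamL_le_Lam [TopologicalSpace U] [T2Space U] [BorelSpace U] (hS : Basic S)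
    {lamL : (Fin n → ℝ) → ℝ}
    (hlamL_nonneg : ∀ y, 0 ≤ lamL y)
    (hlamL_le : ∀ y ∈ S.E, ∀ a ∈ S.feas y, lamL y ≤ S.lam y a)
    {x : Fin n → ℝ} (hx : x ∈ S.E) (Θ : RControl U) (hΘ : S.IsRelaxed x Θ)
    {T : ℝ} (hT : T ∈ S.fs x) (hfin : S.Lam x Θ T < ⊤)
    (hli : IntervalIntegrable (fun s => lamL (S.φ x s)) volume 0 T) :
    ∫ s in (0:ℝ)..T, lamL (S.φ x s) ≤ (S.Lam x Θ T).toReal := by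
  obtain ⟨hae, hint, he⟩ := lam_facts S hS Θ hΘ hT.1 hfin
  rw [← he]
  apply intervalIntegral.integral_mono_ae_restrict hT.1 hli hint
  have hsub : Ioc 0 T ⊆ S.fs x := fun t ht => fs_mono S hT ht.1.le ht.2
  have h3 := ae_restrict_of_ae_restrict_of_subset hsub hΘ.2.2.1
  rw [← restrict_Ioc_eq_restrict_Icc]
  filter_upwards [hae, h3, ae_restrict_mem measurableSet_Ioc] with t h1 h2 htm
  have hE := inE S hS hx (hsub htm)
  have := hΘ.2.1 t
  have hmem : ∀ᵐ u ∂(Θ.time t), u ∈ S.feas (S.φ x t) :=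
    (mem_ae_iff_prob_eq_one
      (hS.feasCompact _ (subset_closure hE)).isClosed.measurableSet).2 h2
  rw [← ENNReal.ofReal_le_iff_le_toReal h1.ne]
  calc ENNReal.ofReal (lamL (S.φ x t))
      = ∫⁻ _, ENNReal.ofReal (lamL (S.φ x t)) ∂(Θ.time t) := by simp
    _ ≤ _ := by
      apply lintegral_mono_ae
      filter_upwards [hmem] with u hu
      exact ENNReal.ofReal_le_ofReal (hlamL_le _ hE u hu)

end

end Aux32

open Aux32

/-- Proposition 3.2 of the paper: an integro-differential *equality* along the flow, for
`v ∈ B_g(E) ∩ M^ac(E)` and under the decay condition (iv), implies the equality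
`v(x) + d·𝓛_α = L_α ℓ + H_α p + G_α k`. -/
theorem prop_3_2 {n : ℕ} {U : Type*} [MeasurableSpace U] [MetricSpace U] [CompactSpace U]
    [BorelSpace U]
    (S : Setting n U) (hS : Basic S)
    (v Xv g ℓ k p lamL : (Fin n → ℝ) → ℝ)
    (hv_mac : S.MemMac v Xv) (hv_nonneg : ∀ y ∈ S.E, 0 ≤ v y)
    (hg_meas : Measurable g) (hg_one : ∀ y, 1 ≤ g y)
    (hv_Bg : S.memBg v g)
    (hlamL_meas : Measurable lamL) (hlamL_nonneg : ∀ y, 0 ≤ lamL y)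
    (hlamL_le : ∀ y ∈ S.E, ∀ a ∈ S.feas y, lamL y ≤ S.lam y a)
    (hl_meas : Measurable ℓ) (hl_nonneg : ∀ y ∈ S.E, 0 ≤ ℓ y)
    (hk_meas : Measurable k) (hk_nonneg : ∀ y ∈ S.E, 0 ≤ k y)
    (hp_meas : Measurable p) (hp_nonneg : ∀ z ∈ frontier S.E, 0 ≤ p z)
    (d α : ℝ) (hd : 0 ≤ d) (hα : 0 ≤ α)
    (Θ : (Fin n → ℝ) → RControl U) (hΘ : ∀ x ∈ S.E, S.IsRelaxed x (Θ x))
    -- (i) finiteness of `Λ^{μ(x)}(x,t)` and of `𝓛_α(x,Θ(x))`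
    (hLam_fin : ∀ x ∈ S.E, ∀ t ∈ S.fs x, S.Lam x (Θ x) t < ⊤)
    (hcurly_fin : ∀ x ∈ S.E, S.curlyL α x (Θ x) < ⊤)
    -- (ii) the integro-differential equality
    -- `Xv - (α + λ(·,μ))v + ℓ + λQk = d` along the flow
    (hdiff : ∀ x ∈ S.E, ∀ t ∈ S.fs x,
      ((Xv (S.φ x t) + ℓ (S.φ x t) : ℝ) : EReal)
          + ((S.lamQMix (fun z => ENNReal.ofReal (k z)) (S.φ x t) ((Θ x).time t) : ℝ≥0∞) :
              EReal)
        = ((d : ℝ) : EReal) + ((α * v (S.φ x t) : ℝ) : EReal)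
          + ((S.lamMix (S.φ x t) ((Θ x).time t) * ENNReal.ofReal (v (S.φ x t)) : ℝ≥0∞) : EReal))
    -- (iii) the boundary equality `v = p + Qk` at `φ(x,t*(x))` when `t*(x) < ∞`
    (hbdry : ∀ x ∈ S.E, S.ts x < ⊤ →
      ((p (S.φ x (S.tsR x)) : ℝ) : EReal)
          + ((S.QMix (fun z => ENNReal.ofReal (k z)) (S.φ x (S.tsR x)) ((Θ x).bdry) : ℝ≥0∞) :
              EReal)
        = ((v (S.φ x (S.tsR x)) : ℝ) : EReal))
    -- (iv) the decay condition `e^{-∫_0^t λ̲(φ(x,s))ds} g(φ(x,t)) → 0` when `t*(x) = ∞`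
    (hlamL_locInt : ∀ x ∈ S.E, ∀ t, 0 ≤ t →
      IntervalIntegrable (fun s => lamL (S.φ x s)) volume 0 t)
    (hdecay : ∀ x ∈ S.E, S.ts x = ⊤ →
      Tendsto (fun t : ℝ =>
          Real.exp (-∫ s in (0:ℝ)..t, lamL (S.φ x s)) * g (S.φ x t)) atTop (𝓝 0))
    (x : Fin n → ℝ) (hx : x ∈ S.E) :
    S.Lop α (fun y _ => ENNReal.ofReal (ℓ y)) x (Θ x)
        + S.Hop α (fun z _ => ENNReal.ofReal (p z)) x (Θ x)
        + S.Gop α (fun z => ENNReal.ofReal (k z)) x (Θ x)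
      = ENNReal.ofReal (v x) + ENNReal.ofReal d * S.curlyL α x (Θ x) := by
  have hcont := cont_flow S hS x
  have hfh := fun (T : ℝ) (hT : T ∈ S.fs x) => finite_horizon S hS
    (q := fun y m => S.lamQMix (fun z => ENNReal.ofReal (k z)) y m) hv_mac hv_nonneg hl_nonneg
    d α hd hα hx (Θ x) (hΘ x hx) (hLam_fin x hx) (hdiff x hx) hT
  have hsplit : S.Lop α (fun y _ => ENNReal.ofReal (ℓ y)) x (Θ x) +
      S.Lop α (fun y m => S.lamQMix (fun z => ENNReal.ofReal (k z)) y m) x (Θ x) =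
      ∫⁻ t in S.fs x, S.weight α x (Θ x) t * (ENNReal.ofReal (ℓ (S.φ x t)) +
        S.lamQMix (fun z => ENNReal.ofReal (k z)) (S.φ x t) ((Θ x).time t)) := by
    simp only [Setting.Lop, mul_add]
    rw [lintegral_add_left]
    exact (weight_meas S α x (Θ x)).mul
      (ENNReal.measurable_ofReal.comp (hl_meas.comp hcont.measurable))
  rw [Setting.Gop]
  by_cases hts : S.ts x < ⊤
  · have hpos := tsR_pos S hS hx hts
    have hofR : ENNReal.ofReal (S.tsR x) = S.ts x := ENNReal.ofReal_toReal hts.ne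
    obtain ⟨T, hTm, hTa, hTl⟩ := exists_seq_strictMono_tendsto' hpos
    have hfsiff : ∀ t, t ∈ S.fs x ↔ 0 ≤ t ∧ t < S.tsR x := by
      intro t
      simp only [Setting.fs, mem_setOf_eq]
      rw [← hofR, ENNReal.ofReal_lt_ofReal_iff hpos]
    have hTfs : ∀ i, T i ∈ S.fs x := fun i => (hfsiff _).2 ⟨(hTa i).1.le, (hTa i).2⟩
    have hU : S.fs x = ⋃ i, Icc 0 (T i) := by
      ext t
      simp only [hfsiff, mem_iUnion, mem_Icc]
      constructor
      · rintro ⟨h1, h2⟩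
        obtain ⟨i, hi⟩ := (hTl.eventually (lt_mem_nhds h2)).exists
        exact ⟨i, h1, hi.le⟩
      · rintro ⟨i, h1, h2⟩
        exact ⟨h1, h2.trans_lt (hTa i).2⟩
    have hVl : Tendsto (fun i => v (S.φ x (T i))) atTop (𝓝 (v (S.φ x (S.tsR x)))) :=
      (hv_mac.2.2.2 x hx hts).comp
        (tendsto_nhdsWithin_iff.2 ⟨hTl, Eventually.of_forall fun i => (hTa i).2⟩)
    have hwl := weight_tendsto S α x (Θ x) T hTm (fun i => (hTa i).2) hTl
      (fun i => hLam_fin x hx _ (hTfs i))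
    have hwt : S.weight α x (Θ x) (S.tsR x) ≠ ⊤ := by
      rw [Setting.weight]
      split_ifs
      · exact ENNReal.zero_ne_top
      · exact ENNReal.ofReal_ne_top
    have hb := ENNReal.Tendsto.mul hwl (Or.inr ENNReal.ofReal_ne_top)
      (ENNReal.tendsto_ofReal hVl) (Or.inr hwt)
    have hlim := limit_pass T hTm.monotone hU _ _
      (fun t => S.weight α x (Θ x) t * ENNReal.ofReal (v (S.φ x t))) _ _ d
      (fun i => hfh (T i) (hTfs i)) hb
    rw [Setting.curlyL, ← hlim, ← hsplit]
    have hp0 := hp_nonneg _ (frontier_ts S hS hts)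
    have hv0 : 0 ≤ v (S.φ x (S.tsR x)) :=
      ge_of_tendsto' hVl fun i => hv_nonneg _ (inE S hS hx (hTfs i))
    have hbd : ENNReal.ofReal (v (S.φ x (S.tsR x))) = ENNReal.ofReal (p (S.φ x (S.tsR x))) +
        S.QMix (fun z => ENNReal.ofReal (k z)) (S.φ x (S.tsR x)) ((Θ x).bdry) := by
      have h := hbdry x hx hts
      rw [← EReal.coe_ennreal_eq_coe_ennreal_iff, EReal.coe_ennreal_add, EReal.coe_ennreal_ofReal,
        EReal.coe_ennreal_ofReal, max_eq_left hv0, max_eq_left hp0, h]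
    rw [hbd]
    simp only [Setting.Hop, if_pos hts, mul_add]
    abel
  · have htop : S.ts x = ⊤ := not_lt_top_iff.1 hts
    have hfsiff : ∀ t, t ∈ S.fs x ↔ 0 ≤ t := by
      intro t
      simp [Setting.fs, htop]
    have hTfs : ∀ i : ℕ, (i : ℝ) ∈ S.fs x := fun i => (hfsiff _).2 i.cast_nonneg
    have hU : S.fs x = ⋃ i : ℕ, Icc (0:ℝ) (i : ℝ) := by
      ext t
      simp only [hfsiff, mem_iUnion, mem_Icc]
      constructor
      · intro h1
        obtain ⟨i, hi⟩ := exists_nat_ge t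
        exact ⟨i, h1, hi⟩
      · rintro ⟨i, h1, h2⟩
        exact h1
    obtain ⟨C, hC⟩ := hv_Bg.2
    have hdec : Tendsto (fun i : ℕ => ENNReal.ofReal
        (C * (Real.exp (-∫ s in (0:ℝ)..(i:ℝ), lamL (S.φ x s)) * g (S.φ x (i:ℝ)))))
        atTop (𝓝 0) := by
      have := ENNReal.tendsto_ofReal
        (((hdecay x hx htop).comp tendsto_natCast_atTop_atTop).const_mul C)
      simpa using this
    have hb : Tendsto (fun i : ℕ => S.weight α x (Θ x) (i:ℝ) * ENNReal.ofReal (v (S.φ x (i:ℝ))))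
        atTop (𝓝 0) := by
      refine tendsto_of_tendsto_of_tendsto_of_le_of_le tendsto_const_nhds hdec
        (fun _ => zero_le) (fun i => ?_)
      have hf := hLam_fin x hx _ (hTfs i)
      have hle := lamL_le_Lam S hS hlamL_nonneg hlamL_le hx (Θ x) (hΘ x hx) (hTfs i) hf
        (hlamL_locInt x hx _ i.cast_nonneg)
      have hE := inE S hS hx (hTfs i)
      have hg0 : 0 < g (S.φ x (i:ℝ)) := lt_of_lt_of_le one_pos (hg_one _)
      have hvC : v (S.φ x (i:ℝ)) ≤ C * g (S.φ x (i:ℝ)) := by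
        have h1 : |v (S.φ x (i:ℝ))| / g (S.φ x (i:ℝ)) ≤ C := hC ⟨_, hE, rfl⟩
        rw [div_le_iff₀ hg0] at h1
        exact (le_abs_self _).trans h1
      have hαi : 0 ≤ α * (i:ℝ) := mul_nonneg hα i.cast_nonneg
      simp only [Setting.weight, if_neg hf.ne]
      rw [← ENNReal.ofReal_mul (Real.exp_pos _).le]
      apply ENNReal.ofReal_le_ofReal
      calc _ ≤ Real.exp (-∫ s in (0:ℝ)..(i:ℝ), lamL (S.φ x s)) * (C * g (S.φ x (i:ℝ))) :=
            mul_le_mul (Real.exp_le_exp.2 (by linarith)) hvC (hv_nonneg _ hE) (Real.exp_pos _).le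
        _ = _ := by ring
    have hlim := limit_pass (fun i : ℕ => (i:ℝ)) Nat.mono_cast hU _ _
      (fun t => S.weight α x (Θ x) t * ENNReal.ofReal (v (S.φ x t))) _ _ d
      (fun i => hfh (i:ℝ) (hTfs i)) hb
    rw [Setting.curlyL, ← hlim, ← hsplit]
    simp only [Setting.Hop, if_neg hts, add_zero]
end

section
/- Under the expected growth condition and the lower-rate condition, for every ordinary feedback selector u : Ē → U, every α ≥ −c and every x ∈ E: g(x) + b·𝓛_α(x,u_φ(x)) ≥ (c+α)·L_α g(x,u_φ(x)) + H_α r̄(x,u_φ(x)) + G_α g(x,u_φ(x)). -/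
open MeasureTheory ENNReal Set Filter Topology

open PDMP MeasureTheory ENNReal Set Filter Topology

namespace PDMPAux

lemma ac_exp {f : ℝ → ℝ} {a b : ℝ} (hf : AbsolutelyContinuousOnInterval f a b) :
    AbsolutelyContinuousOnInterval (fun t => Real.exp (f t)) a b := by
  obtain ⟨C, hC⟩ := hf.exists_bound
  have h1 : ContDiffOn ℝ 1 Real.exp (Icc (-C) C) := Real.contDiff_exp.contDiffOn
  obtain ⟨K, hK⟩ := h1.exists_lipschitzOnWith (by decide) (convex_Icc _ _) isCompact_Icc
  have hmem : ∀ x ∈ uIcc a b, f x ∈ Icc (-C) C := fun x hx => abs_le.1 (hC x hx)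
  rw [absolutelyContinuousOnInterval_iff] at hf ⊢
  intro ε hε
  obtain ⟨δ, hδ, h⟩ := hf (ε / (K + 1)) (by positivity)
  refine ⟨δ, hδ, fun E hE hEs => ?_⟩
  have h2 := h E hE hEs
  calc ∑ i ∈ Finset.range E.1, dist (Real.exp (f (E.2 i).1)) (Real.exp (f (E.2 i).2))
      ≤ ∑ i ∈ Finset.range E.1, K * dist (f (E.2 i).1) (f (E.2 i).2) := by
        refine Finset.sum_le_sum fun i hi => ?_
        have := hE.1 i hi
        exact hK.dist_le_mul _ (hmem _ this.1) _ (hmem _ this.2)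
    _ = K * ∑ i ∈ Finset.range E.1, dist (f (E.2 i).1) (f (E.2 i).2) := by
        rw [Finset.mul_sum]
    _ ≤ (K + 1) * ∑ i ∈ Finset.range E.1, dist (f (E.2 i).1) (f (E.2 i).2) := by
        gcongr
        linarith
    _ < (K + 1) * (ε / (K + 1)) := by gcongr
    _ = ε := by field_simp

lemma parts {l p : ℝ → ℝ} {T : ℝ} (hT : 0 ≤ T) (hl : IntervalIntegrable l volume 0 T)
    (hp : IntervalIntegrable p volume 0 T) (α γ : ℝ) :
    ContinuousOn (fun t => Real.exp (-(α * t) - ∫ s in (0:ℝ)..t, l s)) (Icc 0 T) ∧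
    IntervalIntegrable (fun t => Real.exp (-(α * t) - ∫ s in (0:ℝ)..t, l s) *
      ((α + l t) * (γ + ∫ s in (0:ℝ)..t, p s) - p t)) volume 0 T ∧
    ∫ t in (0:ℝ)..T, Real.exp (-(α * t) - ∫ s in (0:ℝ)..t, l s) *
      ((α + l t) * (γ + ∫ s in (0:ℝ)..t, p s) - p t) =
      γ - Real.exp (-(α * T) - ∫ s in (0:ℝ)..T, l s) * (γ + ∫ s in (0:ℝ)..T, p s) := by
  have hA := hl.absolutelyContinuousOnInterval_intervalIntegral (c := 0) (by simp)
  have hP0 := hp.absolutelyContinuousOnInterval_intervalIntegral (c := 0) (by simp)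
  have hlin : AbsolutelyContinuousOnInterval (fun t : ℝ => -(α * t)) 0 T :=
    (ContDiff.contDiffOn (by fun_prop)).absolutelyContinuousOnInterval
  have hcst : AbsolutelyContinuousOnInterval (fun _ : ℝ => γ) 0 T :=
    (ContDiff.contDiffOn (by fun_prop)).absolutelyContinuousOnInterval
  have hW := ac_exp (hlin.fun_sub hA)
  have hP := hcst.fun_add hP0
  have hWc := hW.continuousOn
  have hPc := hP.continuousOn
  rw [uIcc_of_le hT] at hWc
  refine ⟨hWc, ?_, ?_⟩
  · refine IntervalIntegrable.continuousOn_mul ?_ (by rwa [uIcc_of_le hT])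
    exact ((intervalIntegrable_const.add hl).mul_continuousOn hPc).sub hp
  · have hmain := hW.integral_deriv_mul_eq_sub hP
    simp only [mul_zero, intervalIntegral.integral_same, neg_zero, sub_zero, Real.exp_zero,
      one_mul, add_zero] at hmain
    rw [← neg_sub, ← hmain, ← intervalIntegral.integral_neg]
    refine intervalIntegral.integral_congr_ae ?_
    filter_upwards [hl.ae_hasDerivAt_integral, hp.ae_hasDerivAt_integral] with t h1 h2 ht
    have ht' := uIoc_subset_uIcc ht
    have d1 := h1 ht' 0 (by simp)
    have d2 := h2 ht' 0 (by simp)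
    have d3 : HasDerivAt (fun t : ℝ => -(α * t)) (-α) t := by
      simpa using ((hasDerivAt_id t).const_mul α).fun_neg
    have d4 := (d3.sub d1).exp
    have d5 := d2.const_add γ
    have e4 := d4.deriv
    have e5 := d5.deriv
    simp only [Pi.sub_apply] at e4
    erw [e4, e5]
    ring

lemma stage {l p : ℝ → ℝ} {q : ℝ → ℝ≥0∞} {T α γ b c : ℝ} (hT : 0 ≤ T)
    (hl : IntervalIntegrable l volume 0 T)
    (hp : IntervalIntegrable p volume 0 T) (hγ : 0 ≤ γ) (hb : 0 ≤ b) (hc : 0 ≤ c + α)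
    (P w : ℝ → ℝ) (hP : ∀ t ∈ Icc 0 T, P t = γ + ∫ s in (0:ℝ)..t, p s)
    (hw : ∀ t ∈ Icc 0 T, w t = Real.exp (-(α * t) - ∫ s in (0:ℝ)..t, l s))
    (hP0 : ∀ t, 0 ≤ P t)
    (hd : ∀ t ∈ Icc 0 T, ((p t + c * P t : ℝ) : EReal) +
      ((ENNReal.ofReal (l t) * q t : ℝ≥0∞) : EReal) ≤ ((b + l t * P t : ℝ) : EReal)) :
    (∫⁻ t in Ioc 0 T, (ENNReal.ofReal (c + α) * (ENNReal.ofReal (w t) * ENNReal.ofReal (P t))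
      + ENNReal.ofReal (w t) * (ENNReal.ofReal (l t) * q t))) + ENNReal.ofReal (w T * P T)
      ≤ ENNReal.ofReal γ + ENNReal.ofReal b * ∫⁻ t in Ioc 0 T, ENNReal.ofReal (w t) := by
  obtain ⟨h1, h2, h3⟩ := parts hT hl hp α γ
  set W : ℝ → ℝ := fun t => Real.exp (-(α * t) - ∫ s in (0:ℝ)..t, l s) with hWdef
  have hW0 : ∀ t, 0 ≤ W t := fun t => (Real.exp_pos _).le
  have hWi : IntervalIntegrable W volume 0 T := by
    apply ContinuousOn.intervalIntegrable; rwa [uIcc_of_le hT]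
  set R : ℝ → ℝ := fun t => b * W t + W t * ((α + l t) * (γ + ∫ s in (0:ℝ)..t, p s) - p t)
    with hR
  have hRi : IntervalIntegrable R volume 0 T := (hWi.const_mul b).add h2
  have hRint : ∫ t in (0:ℝ)..T, R t = b * (∫ t in (0:ℝ)..T, W t) + (γ - w T * P T) := by
    rw [hR, intervalIntegral.integral_add (hWi.const_mul b) h2,
      intervalIntegral.integral_const_mul, h3, hw T ⟨hT, le_rfl⟩, hP T ⟨hT, le_rfl⟩]
  have hpt : ∀ t ∈ Ioc 0 T,
      (ENNReal.ofReal (c + α) * (ENNReal.ofReal (w t) * ENNReal.ofReal (P t))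
      + ENNReal.ofReal (w t) * (ENNReal.ofReal (l t) * q t)) ≤ ENNReal.ofReal (R t) ∧
      0 ≤ R t := by
    intro t ht
    have ht' : t ∈ Icc 0 T := ⟨ht.1.le, ht.2⟩
    have hdt := hd t ht'
    have hfin : ENNReal.ofReal (l t) * q t ≠ ⊤ := by
      intro h
      rw [h] at hdt
      simp only [EReal.coe_ennreal_top] at hdt
      rw [EReal.add_top_of_ne_bot (EReal.coe_ne_bot _)] at hdt
      exact EReal.coe_ne_top _ (top_le_iff.1 hdt)
    obtain ⟨v, hv0, hv⟩ : ∃ v : ℝ, 0 ≤ v ∧ ENNReal.ofReal (l t) * q t = ENNReal.ofReal v :=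
      ⟨_, ENNReal.toReal_nonneg, (ENNReal.ofReal_toReal hfin).symm⟩
    rw [hv] at hdt ⊢
    rw [EReal.coe_ennreal_ofReal, max_eq_left hv0] at hdt
    have hdt' : p t + c * P t + v ≤ b + l t * P t := by exact_mod_cast hdt
    have hwt : w t = W t := hw t ht'
    have hle : (c + α) * (W t * P t) + W t * v ≤ R t := by
      have : (c + α) * (W t * P t) + W t * v = W t * ((c + α) * P t + v) := by ring
      rw [this]
      have : R t = W t * (b + (α + l t) * P t - p t) := by
        simp only [hR, hP t ht']; ring
      rw [this]
      exact mul_le_mul_of_nonneg_left (by linarith) (hW0 t)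
    have hnn : 0 ≤ (c + α) * (W t * P t) :=
      mul_nonneg hc (mul_nonneg (hW0 t) (hP0 t))
    have hnn2 : 0 ≤ W t * v := mul_nonneg (hW0 t) hv0
    refine ⟨?_, by linarith⟩
    rw [hwt, ← ENNReal.ofReal_mul (hW0 t), ← ENNReal.ofReal_mul hc, ← ENNReal.ofReal_mul (hW0 t),
      ← ENNReal.ofReal_add hnn hnn2]
    exact ENNReal.ofReal_le_ofReal hle
  have hRnn : ∀ᵐ t ∂(volume.restrict (Ioc 0 T)), 0 ≤ R t := by
    filter_upwards [ae_restrict_mem measurableSet_Ioc] with t ht using (hpt t ht).2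
  have hlint : ∫⁻ t in Ioc 0 T, ENNReal.ofReal (R t) = ENNReal.ofReal (∫ t in (0:ℝ)..T, R t) := by
    rw [intervalIntegral.integral_of_le hT,
      ofReal_integral_eq_lintegral_ofReal ((intervalIntegrable_iff_integrableOn_Ioc_of_le hT).1 hRi)
        hRnn]
  have hRnn' : 0 ≤ ∫ t in (0:ℝ)..T, R t := by
    rw [intervalIntegral.integral_of_le hT]; exact integral_nonneg_of_ae hRnn
  have hwlint : ∫⁻ t in Ioc 0 T, ENNReal.ofReal (w t) = ENNReal.ofReal (∫ t in (0:ℝ)..T, W t) := by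
    rw [intervalIntegral.integral_of_le hT,
      ofReal_integral_eq_lintegral_ofReal ((intervalIntegrable_iff_integrableOn_Ioc_of_le hT).1 hWi)
        (ae_of_all _ hW0)]
    exact setLIntegral_congr_fun measurableSet_Ioc fun t ht => by
      simp only [hw t ⟨ht.1.le, ht.2⟩, hWdef]
  have hWI : 0 ≤ ∫ t in (0:ℝ)..T, W t :=
    intervalIntegral.integral_nonneg_of_forall hT hW0
  have hwP : 0 ≤ w T * P T := mul_nonneg (by rw [hw T ⟨hT, le_rfl⟩]; exact hW0 T) (hP0 T)
  calc _ ≤ (∫⁻ t in Ioc 0 T, ENNReal.ofReal (R t)) + ENNReal.ofReal (w T * P T) := by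
        gcongr ?_ + _
        exact setLIntegral_mono' measurableSet_Ioc fun t ht => (hpt t ht).1
    _ = ENNReal.ofReal (γ + b * ∫ t in (0:ℝ)..T, W t) := by
        rw [hlint, ← ENNReal.ofReal_add hRnn' hwP, hRint]; congr 1; ring
    _ = _ := by
        rw [hwlint, ENNReal.ofReal_add hγ (mul_nonneg hb hWI), ENNReal.ofReal_mul hb]

variable {n : ℕ} {U : Type*} [MeasurableSpace U] {S : Setting n U}

lemma flow_mem [TopologicalSpace U] (hS : Basic S) {x : Fin n → ℝ} (hx : x ∈ S.E) {t : ℝ}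
    (ht : t ∈ S.fs x) : S.φ x t ∈ S.E := by
  have hcont : Continuous fun s => S.φ x s :=
    hS.contFlow.comp (Continuous.prodMk continuous_const continuous_id)
  have hsub : Icc 0 t ⊆ (fun s => S.φ x s) ⁻¹' S.E := by
    refine isPreconnected_Icc.subset_left_of_subset_union (hS.openE.preimage hcont)
      (isClosed_closure.isOpen_compl.preimage hcont :
        IsOpen ((fun s => S.φ x s) ⁻¹' (closure S.E)ᶜ)) ?_ ?_ ?_
    · refine Disjoint.preimage _ ?_
      exact disjoint_compl_right.mono_left subset_closure
    · intro s hs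
      by_contra hcon
      simp only [mem_union, mem_preimage, mem_compl_iff, not_or, not_not] at hcon
      have hfr : S.φ x s ∈ frontier S.E := by
        rw [hS.openE.frontier_eq]; exact ⟨hcon.2, hcon.1⟩
      have hs0 : 0 < s := by
        rcases hs.1.eq_or_lt with h | h
        · exfalso; rw [← h, hS.flowZero] at hcon; exact hcon.1 hx
        · exact h
      have h1 : S.ts x ≤ ENNReal.ofReal s := sInf_le ⟨s, hs0, hfr, rfl⟩
      exact absurd ht.2 (not_lt.2 (h1.trans (ENNReal.ofReal_le_ofReal hs.2)))
    · exact ⟨0, ⟨le_rfl, ht.1⟩, by simpa [hS.flowZero] using hx⟩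
  exact hsub ⟨ht.1, le_rfl⟩

lemma ts_pos [TopologicalSpace U] (hS : Basic S) {x : Fin n → ℝ} (hx : x ∈ S.E) :
    0 < S.ts x := by
  have hcont : Continuous fun s => S.φ x s :=
    hS.contFlow.comp (Continuous.prodMk continuous_const continuous_id)
  have h0 : (fun s => S.φ x s) ⁻¹' S.E ∈ 𝓝 (0:ℝ) :=
    (hS.openE.preimage hcont).mem_nhds (by simpa [hS.flowZero] using hx)
  obtain ⟨ε, hε, hball⟩ := Metric.mem_nhds_iff.1 h0
  refine lt_of_lt_of_le (ENNReal.ofReal_pos.2 hε) (le_sInf ?_)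
  rintro _ ⟨t, ht, hfr, rfl⟩
  refine ENNReal.ofReal_le_ofReal ?_
  by_contra hlt
  have : S.φ x t ∈ S.E := hball (by
    rw [Metric.mem_ball, Real.dist_eq, sub_zero, abs_of_pos ht]; linarith)
  rw [hS.openE.frontier_eq] at hfr
  exact hfr.2 this

lemma flow_mem_closure [TopologicalSpace U] (hS : Basic S) {x : Fin n → ℝ} (hx : x ∈ S.E) {t : ℝ}
    (ht0 : 0 ≤ t) (ht : ENNReal.ofReal t ≤ S.ts x) : S.φ x t ∈ closure S.E := by
  have hcont : Continuous fun s => S.φ x s :=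
    hS.contFlow.comp (Continuous.prodMk continuous_const continuous_id)
  rcases ht.eq_or_lt with h | h
  · have htp : 0 < t := by
      have := ts_pos hS hx
      rw [← h] at this
      exact ENNReal.ofReal_pos.1 this
    have hmem : t ∈ closure (Ico 0 t) := by
      rw [closure_Ico htp.ne]; exact ⟨ht0, le_rfl⟩
    refine (hcont.continuousWithinAt (s := Ico 0 t) (x := t)).mem_closure hmem ?_
    intro s hs
    refine flow_mem hS hx ⟨hs.1, lt_of_lt_of_le ?_ ht⟩
    exact (ENNReal.ofReal_lt_ofReal_iff htp).2 hs.2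
  · exact subset_closure (flow_mem hS hx ⟨ht0, h⟩)

lemma ts_finite {x : Fin n → ℝ} (h : S.ts x < ⊤) : ENNReal.ofReal (S.tsR x) = S.ts x :=
  ENNReal.ofReal_toReal h.ne

section
variable [MetricSpace U] [BorelSpace U]

lemma meas_l (hS : Basic S) {u : (Fin n → ℝ) → U} (hu : S.IsSelector u) (x : Fin n → ℝ) :
    Measurable fun t => S.lam (S.φ x t) (u (S.φ x t)) := by
  have hcont : Continuous fun s => S.φ x s :=
    hS.contFlow.comp (Continuous.prodMk continuous_const continuous_id)
  exact hS.lamMeas.comp (hcont.measurable.prodMk (hu.1.comp hcont.measurable))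

lemma l_int {c Kl : ℝ} {lamL : (Fin n → ℝ) → ℝ} (hS : Basic S) (hLR : LowerRate S c lamL Kl)
    {u : (Fin n → ℝ) → U} (hu : S.IsSelector u) {x : Fin n → ℝ} (hx : x ∈ S.E) {t : ℝ}
    (ht0 : 0 ≤ t) (ht : ENNReal.ofReal t ≤ S.ts x) :
    IntervalIntegrable (fun s => S.lam (S.φ x s) (u (S.φ x s))) volume 0 t ∧
    ∀ α : ℝ, S.weight α x (S.feedback u x) t =
      ENNReal.ofReal (Real.exp (-(α * t) - ∫ s in (0:ℝ)..t, S.lam (S.φ x s) (u (S.φ x s)))) := by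
  have hcl : ∀ s ∈ Ioc 0 t, S.φ x s ∈ closure S.E := fun s hs =>
    flow_mem_closure hS hx hs.1.le ((ENNReal.ofReal_le_ofReal hs.2).trans ht)
  have hnn : ∀ᵐ s ∂(volume.restrict (Ioc 0 t)), 0 ≤ S.lam (S.φ x s) (u (S.φ x s)) := by
    filter_upwards [ae_restrict_mem measurableSet_Ioc] with s hs
    exact hS.lamNonneg _ (hcl s hs) _
  have hsup : (∫⁻ s in Ioc (0 : ℝ) t, ⨆ a ∈ S.feas (S.φ x s),
      ENNReal.ofReal (S.lam (S.φ x s) a)) < ⊤ := by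
    rcases ht.eq_or_lt with h | h
    · have hfin : S.ts x < ⊤ := by rw [← h]; exact ENNReal.ofReal_lt_top
      have : S.tsR x = t := by rw [Setting.tsR, ← h, ENNReal.toReal_ofReal ht0]
      rw [← this]
      exact hLR.supIntTs x hx hfin
    · exact hLR.supInt x hx t ⟨ht0, h⟩
  have hfin : (∫⁻ s in Ioc (0 : ℝ) t, ENNReal.ofReal (S.lam (S.φ x s) (u (S.φ x s)))) < ⊤ := by
    refine lt_of_le_of_lt (setLIntegral_mono' measurableSet_Ioc fun s hs => ?_) hsup
    exact le_iSup₂ (f := fun a (_ : a ∈ S.feas (S.φ x s)) => ENNReal.ofReal (S.lam (S.φ x s) a))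
      (u (S.φ x s)) (hu.2 _ (hcl s hs))
  have hint : IntegrableOn (fun s => S.lam (S.φ x s) (u (S.φ x s))) (Ioc 0 t) := by
    refine ⟨(meas_l hS hu x).aestronglyMeasurable, ?_⟩
    rw [hasFiniteIntegral_iff_ofReal hnn]
    exact hfin
  have hLam : S.Lam x (S.feedback u x) t =
      ENNReal.ofReal (∫ s in (0:ℝ)..t, S.lam (S.φ x s) (u (S.φ x s))) := by
    rw [intervalIntegral.integral_of_le ht0, ofReal_integral_eq_lintegral_ofReal hint hnn]
    simp only [Setting.Lam, Setting.lamMix, Setting.feedback, lintegral_dirac]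
  refine ⟨(intervalIntegrable_iff_integrableOn_Ioc_of_le ht0).2 hint, fun α => ?_⟩
  rw [Setting.weight, hLam, if_neg ENNReal.ofReal_ne_top, ENNReal.toReal_ofReal]
  rw [intervalIntegral.integral_of_le ht0]
  exact integral_nonneg_of_ae hnn

end

lemma weight_meas (α : ℝ) (x : Fin n → ℝ) (Θ : RControl U) :
    Measurable (S.weight α x Θ) := by
  have hmono : Monotone (S.Lam x Θ) := fun a b hab =>
    lintegral_mono_set (Ioc_subset_Ioc_right hab)
  have hm := hmono.measurable
  unfold Setting.weight
  refine Measurable.ite (hm (measurableSet_singleton ⊤)) measurable_const ?_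
  exact ENNReal.measurable_ofReal.comp (Real.measurable_exp.comp
    (((measurable_const.mul measurable_id).neg).sub hm.ennreal_toReal))

lemma exhaust {x : Fin n → ℝ} (hpos : 0 < S.ts x) : ∃ T : ℕ → ℝ, Monotone T ∧
    (∀ k, T k ∈ S.fs x) ∧ (S.ts x < ⊤ → Tendsto T atTop (𝓝[<] (S.tsR x))) ∧
    (⋃ k, Ioc 0 (T k)) =ᵐ[volume] S.fs x := by
  rcases eq_or_ne (S.ts x) ⊤ with htop | hne
  · refine ⟨fun k => k, Nat.mono_cast, fun k => ⟨k.cast_nonneg, by simp [htop]⟩,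
      fun h => absurd htop h.ne, ?_⟩
    have h1 : S.fs x = Ici 0 := by ext t; simp [Setting.fs, htop]
    have h2 : (⋃ k : ℕ, Ioc (0:ℝ) k) = Ioi 0 := by
      ext t
      simp only [mem_iUnion, mem_Ioc, mem_Ioi]
      exact ⟨fun ⟨k, h, _⟩ => h, fun h => (exists_nat_ge t).imp fun k hk => ⟨h, hk⟩⟩
    rw [h1, h2]
    exact Ioi_ae_eq_Ici
  · have hp : 0 < S.tsR x := ENNReal.toReal_pos hpos.ne' hne
    have hts : ENNReal.ofReal (S.tsR x) = S.ts x := ENNReal.ofReal_toReal hne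
    obtain ⟨T, hT1, hT2, hT3⟩ := exists_seq_strictMono_tendsto' hp
    have h1 : S.fs x = Ico 0 (S.tsR x) := by
      ext t
      simp only [Setting.fs, mem_ofPred_eq, mem_Ico, ← hts]
      rw [ENNReal.ofReal_lt_ofReal_iff hp]
    refine ⟨T, hT1.monotone, fun k => ?_, fun _ => ?_, ?_⟩
    · rw [h1]; exact ⟨(hT2 k).1.le, (hT2 k).2⟩
    · exact tendsto_nhdsWithin_iff.2 ⟨hT3, Eventually.of_forall fun k => (hT2 k).2⟩
    · have h2 : (⋃ k : ℕ, Ioc (0:ℝ) (T k)) = Ioo 0 (S.tsR x) := by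
        ext t
        simp only [mem_iUnion, mem_Ioc, mem_Ioo]
        refine ⟨fun ⟨k, h, h'⟩ => ⟨h, h'.trans_lt (hT2 k).2⟩, fun h => ?_⟩
        obtain ⟨k, hk⟩ := (hT3.eventually (lt_mem_nhds h.2)).exists
        exact ⟨k, h.1, hk.le⟩
      rw [h1, h2]
      exact Ioo_ae_eq_Ico

lemma exhaust_lintegral {T : ℕ → ℝ} (hT : Monotone T) {s : Set ℝ}
    (hs : (⋃ k, Ioc 0 (T k)) =ᵐ[volume] s) (F : ℝ → ℝ≥0∞) :
    Tendsto (fun k => ∫⁻ t in Ioc 0 (T k), F t) atTop (𝓝 (∫⁻ t in s, F t)) := by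
  have h := tendsto_measure_iUnion_atTop (μ := volume.withDensity F)
    (s := fun k => Ioc 0 (T k)) (fun a b hab => Ioc_subset_Ioc_right (hT hab))
  rw [withDensity_apply _ (MeasurableSet.iUnion fun _ => measurableSet_Ioc),
    setLIntegral_congr hs] at h
  refine h.congr fun k => ?_
  simp only [Function.comp, withDensity_apply _ measurableSet_Ioc]

end PDMPAux

open PDMP MeasureTheory ENNReal Set Filter Topology

/-- The first inequality (intw) of Corollary 3.3 of the paper: under the expected growth and
lower-rate conditions, for every ordinary feedback selector `u`, every `α ≥ -c` and `x ∈ E`,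
`g(x) + b·𝓛_α(x,u_φ(x)) ≥ (c+α)·L_α g(x,u_φ(x)) + H_α r̄(x,u_φ(x)) + G_α g(x,u_φ(x))`. -/
theorem corollary_3_3_intw {n : ℕ} {U : Type*} [MeasurableSpace U] [MetricSpace U]
    [CompactSpace U] [BorelSpace U]
    (S : Setting n U) (hS : Basic S)
    (b c : ℝ) (g Xg rbar lamL : (Fin n → ℝ) → ℝ) (Kl : ℝ)
    (hEG : ExpGrowth S b c g Xg rbar) (hLR : LowerRate S c lamL Kl)
    (u : (Fin n → ℝ) → U) (hu : S.IsSelector u)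
    (α : ℝ) (hα : -c ≤ α) (x : Fin n → ℝ) (hx : x ∈ S.E) :
    ENNReal.ofReal (c + α) * S.Lop α (fun y _ => ENNReal.ofReal (g y)) x (S.feedback u x)
        + S.Hop α (fun z _ => ENNReal.ofReal (rbar z)) x (S.feedback u x)
        + S.Gop α (fun z => ENNReal.ofReal (g z)) x (S.feedback u x)
      ≤ ENNReal.ofReal (g x) + ENNReal.ofReal b * S.curlyL α x (S.feedback u x) := by
  classical
  have hcont : Continuous fun s => S.φ x s :=
    hS.contFlow.comp (Continuous.prodMk continuous_const continuous_id)
  obtain ⟨T, hTm, hTf, hTt, hTu⟩ := PDMPAux.exhaust (S := S) (PDMPAux.ts_pos hS hx)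
  have hg0 : ∀ y, 0 ≤ g y := fun y => zero_le_one.trans (hEG.g_ge_one y)
  have hcα : 0 ≤ c + α := by linarith
  set Θ := S.feedback u x with hΘ
  set l : ℝ → ℝ := fun s => S.lam (S.φ x s) (u (S.φ x s)) with hl
  set q : ℝ → ℝ≥0∞ := fun s => S.Qpt (fun z => ENNReal.ofReal (g z)) (S.φ x s) (u (S.φ x s))
    with hq
  set w : ℝ → ℝ := fun t => Real.exp (-(α * t) - ∫ s in (0:ℝ)..t, l s) with hw
  have hw0 : ∀ t, 0 ≤ w t := fun t => (Real.exp_pos _).le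
  have hweight : ∀ t, 0 ≤ t → ENNReal.ofReal t ≤ S.ts x →
      S.weight α x Θ t = ENNReal.ofReal (w t) := fun t h0 h1 =>
    (PDMPAux.l_int hS hLR hu hx h0 h1).2 α
  have hdown : ∀ T' ∈ S.fs x, ∀ t ∈ Icc 0 T', t ∈ S.fs x := fun T' hT' t ht =>
    ⟨ht.1, (ENNReal.ofReal_le_ofReal ht.2).trans_lt hT'.2⟩
  set F : ℝ → ℝ≥0∞ := fun t =>
    ENNReal.ofReal (c + α) * (S.weight α x Θ t * ENNReal.ofReal (g (S.φ x t)))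
      + S.weight α x Θ t * (ENNReal.ofReal (l t) * q t) with hF
  have hstage : ∀ k, (∫⁻ t in Ioc 0 (T k), F t) + ENNReal.ofReal (w (T k) * g (S.φ x (T k)))
      ≤ ENNReal.ofReal (g x) + ENNReal.ofReal b * S.curlyL α x Θ := by
    intro k
    have hTk := hTf k
    have hmac := hEG.g_mac.2.2.1 x hx
    have key := PDMPAux.stage (l := l) (p := fun s => Xg (S.φ x s)) (q := q) (T := T k) (α := α)
      (γ := g x) (b := b) (c := c) hTk.1 (PDMPAux.l_int hS hLR hu hx hTk.1 hTk.2.le).1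
      (hmac (T k) hTk).1 (hg0 x) hEG.b_nonneg hcα (fun t => g (S.φ x t)) w
      (fun t ht => by
        have := (hmac t (hdown _ hTk t ht)).2
        linarith)
      (fun t _ => rfl) (fun t => hg0 _)
      (fun t ht => hEG.drift _ (PDMPAux.flow_mem hS hx (hdown _ hTk t ht)) _
        (hu.2 _ (subset_closure (PDMPAux.flow_mem hS hx (hdown _ hTk t ht)))))
    have hwt : ∀ t ∈ Ioc 0 (T k), S.weight α x Θ t = ENNReal.ofReal (w t) := fun t ht =>
      hweight t ht.1.le (hdown _ hTk t ⟨ht.1.le, ht.2⟩).2.le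
    have e1 : ∫⁻ t in Ioc 0 (T k), F t = ∫⁻ t in Ioc 0 (T k),
        (ENNReal.ofReal (c + α) * (ENNReal.ofReal (w t) * ENNReal.ofReal (g (S.φ x t)))
          + ENNReal.ofReal (w t) * (ENNReal.ofReal (l t) * q t)) :=
      setLIntegral_congr_fun measurableSet_Ioc fun t ht => by simp only [hF, hwt t ht]
    have e2 : ∫⁻ t in Ioc 0 (T k), ENNReal.ofReal (w t) ≤ S.curlyL α x Θ := by
      rw [Setting.curlyL]
      calc ∫⁻ t in Ioc 0 (T k), ENNReal.ofReal (w t)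
          = ∫⁻ t in Ioc 0 (T k), S.weight α x Θ t :=
            setLIntegral_congr_fun measurableSet_Ioc fun t ht => (hwt t ht).symm
        _ ≤ _ := lintegral_mono_set fun t ht => hdown _ hTk t ⟨ht.1.le, ht.2⟩
    rw [e1]
    exact key.trans (by gcongr)
  have hlim := PDMPAux.exhaust_lintegral hTm hTu F
  have hmeas1 : Measurable fun t => S.weight α x Θ t * ENNReal.ofReal (g (S.φ x t)) :=
    (PDMPAux.weight_meas α x Θ).mul
      (ENNReal.measurable_ofReal.comp (hEG.g_mac.1.comp hcont.measurable))
  have hFint : ∫⁻ t in S.fs x, F t =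
      ENNReal.ofReal (c + α) * S.Lop α (fun y _ => ENNReal.ofReal (g y)) x Θ
      + S.Lop α (fun y m => S.lamQMix (fun z => ENNReal.ofReal (g z)) y m) x Θ := by
    simp only [hF]
    rw [lintegral_add_left (hmeas1.const_mul _), lintegral_const_mul _ hmeas1]
    simp only [Setting.Lop, Setting.lamQMix, hΘ, Setting.feedback, lintegral_dirac, hl, hq]
  have hLHS : ENNReal.ofReal (c + α) * S.Lop α (fun y _ => ENNReal.ofReal (g y)) x Θ
        + S.Hop α (fun z _ => ENNReal.ofReal (rbar z)) x Θ
        + S.Gop α (fun z => ENNReal.ofReal (g z)) x Θ =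
      (∫⁻ t in S.fs x, F t) + (S.Hop α (fun z _ => ENNReal.ofReal (rbar z)) x Θ
        + S.Hop α (fun y m => S.QMix (fun z => ENNReal.ofReal (g z)) y m) x Θ) := by
    rw [hFint, Setting.Gop]; ring
  rw [hLHS]
  by_cases hfin : S.ts x < ⊤
  · have hts := PDMPAux.ts_finite hfin
    have hR0 : 0 ≤ S.tsR x := ENNReal.toReal_nonneg
    have hH : S.Hop α (fun z _ => ENNReal.ofReal (rbar z)) x Θ
        + S.Hop α (fun y m => S.QMix (fun z => ENNReal.ofReal (g z)) y m) x Θ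
        ≤ ENNReal.ofReal (w (S.tsR x) * g (S.φ x (S.tsR x))) := by
      simp only [Setting.Hop, if_pos hfin]
      rw [← mul_add, hweight _ hR0 hts.le, ENNReal.ofReal_mul (hw0 _)]
      gcongr
      simp only [Setting.QMix, hΘ, Setting.feedback, lintegral_dirac]
      exact hEG.bdryGrowth x hx hfin _
        (hu.2 _ (PDMPAux.flow_mem_closure hS hx hR0 hts.le))
    refine (add_le_add_right hH _).trans ?_
    have hli := (PDMPAux.l_int hS hLR hu hx hR0 hts.le).1
    have hwc : ContinuousOn w (Icc 0 (S.tsR x)) :=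
      (PDMPAux.parts hR0 hli hli α 0).1
    have hT' := hTt hfin
    have hTlt : ∀ k, T k ∈ Icc 0 (S.tsR x) := fun k =>
      ⟨(hTf k).1, (ENNReal.ofReal_le_ofReal_iff hR0).1 ((hTf k).2.le.trans hts.ge)⟩
    have hwl : Tendsto (fun k => w (T k)) atTop (𝓝 (w (S.tsR x))) :=
      (hwc _ ⟨hR0, le_rfl⟩).tendsto.comp
        (tendsto_nhdsWithin_iff.2 ⟨hT'.mono_right nhdsWithin_le_nhds, Eventually.of_forall hTlt⟩)
    have hgl : Tendsto (fun k => g (S.φ x (T k))) atTop (𝓝 (g (S.φ x (S.tsR x)))) :=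
      (hEG.g_mac.2.2.2 x hx hfin).comp hT'
    exact le_of_tendsto' (hlim.add (ENNReal.tendsto_ofReal (hwl.mul hgl))) hstage
  · simp only [Setting.Hop, if_neg hfin, add_zero]
    exact le_of_tendsto' hlim fun k => le_self_add.trans (hstage k)
end

section
/- Under the expected growth condition and the lower-rate condition, for every x ∈ E, every α ≥ −c and every relaxed control Θ ∈ V^r(x): (c+α)·L_α g(x,Θ) + H_α r̄(x,Θ) + G_α g(x,Θ) ≤ b·K_λ + g(x). -/
open MeasureTheory ENNReal Set Filter Topology

open PDMP MeasureTheory ENNReal Set Filter Topology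

namespace PDMPaux

variable {n : ℕ} {U : Type*} [MeasurableSpace U]

theorem ts_le (S : Setting n U) {x : Fin n → ℝ} {t : ℝ} (ht : 0 < t)
    (h : S.φ x t ∈ frontier S.E) : S.ts x ≤ ENNReal.ofReal t :=
  sInf_le ⟨t, ht, h, rfl⟩

theorem cont_flow [TopologicalSpace U] {S : Setting n U} (hS : Basic S) (x : Fin n → ℝ) :
    Continuous (S.φ x) := by
  have := hS.contFlow.comp (Continuous.prodMk_right x)
  exact this

theorem mem_E [TopologicalSpace U] {S : Setting n U} (hS : Basic S) {x : Fin n → ℝ} (hx : x ∈ S.E)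
    {t : ℝ} (ht : t ∈ S.fs x) : S.φ x t ∈ S.E := by
  have hpre : IsPreconnected (S.φ x '' Icc 0 t) :=
    isPreconnected_Icc.image _ (cont_flow hS x).continuousOn
  have h := hpre.subset_left_of_subset_union hS.openE
    (isClosed_closure (s := S.E)).isOpen_compl
    (disjoint_compl_right.mono_left subset_closure) ?_ ?_
  · exact h ⟨t, ⟨ht.1, le_rfl⟩, rfl⟩
  · rintro _ ⟨s, hs, rfl⟩
    by_contra hcon
    simp only [mem_union, mem_compl_iff, not_or, not_not] at hcon
    have hfr : S.φ x s ∈ frontier S.E := by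
      rw [hS.openE.frontier_eq]; exact ⟨hcon.2, hcon.1⟩
    have hs0 : 0 < s := by
      rcases hs.1.eq_or_lt with h0 | h0
      · exfalso; apply hcon.1; rw [← h0, hS.flowZero]; exact hx
      · exact h0
    have h1 := ts_le S hs0 hfr
    have h2 := ht.2
    have h3 := ENNReal.ofReal_le_ofReal hs.2
    exact absurd (h2.trans_le (h1.trans h3)) (lt_irrefl _)
  · exact ⟨x, ⟨0, ⟨le_rfl, ht.1⟩, hS.flowZero x⟩, hx⟩

theorem ts_pos [TopologicalSpace U] {S : Setting n U} (hS : Basic S) {x : Fin n → ℝ}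
    (hx : x ∈ S.E) : 0 < S.ts x := by
  have h1 : ∀ᶠ t in 𝓝 (0:ℝ), S.φ x t ∈ S.E := by
    apply (cont_flow hS x).continuousAt
    rw [hS.flowZero]
    exact hS.openE.mem_nhds hx
  obtain ⟨ε, hε, h⟩ := Metric.eventually_nhds_iff.1 h1
  refine lt_of_lt_of_le (ENNReal.ofReal_pos.2 hε) (le_sInf ?_)
  rintro _ ⟨t, ht, hf, rfl⟩
  apply ENNReal.ofReal_le_ofReal
  by_contra hcon
  have := h (y := t) (by rw [Real.dist_eq, sub_zero, abs_of_pos ht]; linarith)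
  rw [hS.openE.frontier_eq] at hf
  exact hf.2 this

theorem mem_fs_of_lt {S : Setting n U} {x : Fin n → ℝ} (hts : S.ts x < ⊤) {t : ℝ} (h0 : 0 ≤ t)
    (h : t < S.tsR x) : t ∈ S.fs x :=
  ⟨h0, (ENNReal.ofReal_lt_iff_lt_toReal h0 hts.ne).2 h⟩

theorem mem_fs_mono {S : Setting n U} {x : Fin n → ℝ} {s t : ℝ} (h0 : 0 ≤ s) (h : s ≤ t)
    (ht : t ∈ S.fs x) : s ∈ S.fs x :=
  ⟨h0, (ENNReal.ofReal_le_ofReal h).trans_lt ht.2⟩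

theorem tsR_closure [TopologicalSpace U] {S : Setting n U} (hS : Basic S) {x : Fin n → ℝ}
    (hx : x ∈ S.E) (hts : S.ts x < ⊤) : S.φ x (S.tsR x) ∈ closure S.E := by
  have hpos : 0 < S.tsR x := ENNReal.toReal_pos (ts_pos hS hx).ne' hts.ne
  have h1 : Tendsto (S.φ x) (𝓝[<] S.tsR x) (𝓝 (S.φ x (S.tsR x))) :=
    ((cont_flow hS x).tendsto _).mono_left nhdsWithin_le_nhds
  refine mem_closure_of_tendsto h1 ?_
  filter_upwards [Ioo_mem_nhdsLT hpos] with t ht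
  exact mem_E hS hx (mem_fs_of_lt hts ht.1.le ht.2)

theorem restrict_le (S : Setting n U) {x : Fin n → ℝ} {T : ℝ} (hT : T ∈ S.fs x) :
    (volume.restrict (Ioc 0 T)) ≤ volume.restrict (S.fs x) :=
  Measure.restrict_mono (fun _ hs => mem_fs_mono hs.1.le hs.2 hT) le_rfl

theorem restrict_le' (S : Setting n U) {x : Fin n → ℝ} (hts : S.ts x < ⊤) :
    (volume.restrict (Ioc 0 (S.tsR x))) ≤ volume.restrict (S.fs x) := by
  rw [← Measure.restrict_congr_set (Ioo_ae_eq_Ioc (a := (0:ℝ)) (b := S.tsR x))]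
  exact Measure.restrict_mono (fun _ hs => mem_fs_of_lt hts hs.1.le hs.2) le_rfl

theorem fs_meas (S : Setting n U) (x : Fin n → ℝ) : MeasurableSet (S.fs x) :=
  measurableSet_Ici.inter
    (measurableSet_lt ENNReal.measurable_ofReal measurable_const)

theorem meas_mix {Y : (Fin n → ℝ) → U → ℝ≥0∞} (hY : Measurable (Function.uncurry Y))
    [TopologicalSpace U] {S : Setting n U} (hS : Basic S) (x : Fin n → ℝ) {Θ : RControl U}
    (hΘ : S.IsRelaxed x Θ) : Measurable fun t => ∫⁻ u, Y (S.φ x t) u ∂(Θ.time t) := by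
  let κ : ProbabilityTheory.Kernel ℝ U := ⟨Θ.time, hΘ.1⟩
  have : ProbabilityTheory.IsMarkovKernel κ := ⟨fun t => hΘ.2.1 t⟩
  have hm : Measurable (Function.uncurry fun (t : ℝ) (u : U) => Y (S.φ x t) u) := by
    have := hY.comp (((cont_flow hS x).measurable.comp measurable_fst).prodMk
      (measurable_snd (α := ℝ) (β := U)))
    exact this
  exact Measurable.lintegral_kernel_prod_right (κ := κ) hm

theorem meas_Qpt [TopologicalSpace U] {S : Setting n U} (hS : Basic S)
    {k : (Fin n → ℝ) → ℝ≥0∞} (hk : Measurable k) :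
    Measurable (Function.uncurry (S.Qpt k)) := by
  have h : Function.uncurry (S.Qpt k)
      = fun p : (Fin n → ℝ) × U => ∫⁻ z, S.E.indicator k z ∂(S.Q p.1 p.2) := by
    funext p
    simp only [Function.uncurry, Setting.Qpt]
    rw [lintegral_indicator hS.openE.measurableSet]
  rw [h]
  exact (Measure.measurable_lintegral (hk.indicator hS.openE.measurableSet)).comp hS.Qmeas

theorem meas_lam [TopologicalSpace U] {S : Setting n U} (hS : Basic S) :
    Measurable (Function.uncurry fun y u => ENNReal.ofReal (S.lam y u)) :=
  ENNReal.measurable_ofReal.comp hS.lamMeas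

theorem ae_feas [TopologicalSpace U] [T2Space U] [BorelSpace U] {S : Setting n U} (hS : Basic S)
    {y : Fin n → ℝ} (hy : y ∈ closure S.E) {m : Measure U} [IsProbabilityMeasure m]
    (h : m (S.feas y) = 1) : ∀ᵐ u ∂m, u ∈ S.feas y := by
  rwa [← prob_compl_eq_zero_iff (hS.feasCompact y hy).measurableSet] at h

/-- pointwise integrated drift inequality -/
theorem drift_int [TopologicalSpace U] {S : Setting n U} (hS : Basic S)
    {b c : ℝ} {g Xg rbar : (Fin n → ℝ) → ℝ} (hEG : ExpGrowth S b c g Xg rbar)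
    {y : Fin n → ℝ} (hy : y ∈ S.E) {m : Measure U} [IsProbabilityMeasure m]
    (h : ∀ᵐ u ∂m, u ∈ S.feas y) (hfin : S.lamMix y m < ⊤) :
    0 ≤ b + (S.lamMix y m).toReal * g y - (Xg y + c * g y) ∧
    S.lamQMix (fun z => ENNReal.ofReal (g z)) y m
      ≤ ENNReal.ofReal (b + (S.lamMix y m).toReal * g y - (Xg y + c * g y)) := by
  have hlm : Measurable (S.lam y) := hS.lamMeas.comp measurable_prodMk_left
  have hl0 : ∀ u, 0 ≤ S.lam y u := hS.lamNonneg y (subset_closure hy)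
  have hint : Integrable (S.lam y) m := by
    refine ⟨hlm.aestronglyMeasurable, ?_⟩
    rw [hasFiniteIntegral_iff_ofReal (Eventually.of_forall hl0)]
    exact hfin
  have hval : ∫ u, S.lam y u ∂m = (S.lamMix y m).toReal := by
    rw [integral_eq_lintegral_of_nonneg_ae (Eventually.of_forall hl0) hlm.aestronglyMeasurable]
    rfl
  have hpt : ∀ a ∈ S.feas y, 0 ≤ b + S.lam y a * g y - (Xg y + c * g y) ∧
      ENNReal.ofReal (S.lam y a) * S.Qpt (fun z => ENNReal.ofReal (g z)) y a
        ≤ ENNReal.ofReal (b + S.lam y a * g y - (Xg y + c * g y)) := by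
    intro a ha
    have hd := hEG.drift y hy a ha
    generalize ENNReal.ofReal (S.lam y a) * S.Qpt (fun z => ENNReal.ofReal (g z)) y a = q at hd ⊢
    induction q with
    | top =>
      exfalso
      rw [EReal.coe_ennreal_top, EReal.coe_add_top, top_le_iff] at hd
      exact EReal.coe_ne_top _ hd
    | coe q =>
      have e : (((q : ℝ≥0∞)) : EReal) = ((q : ℝ) : EReal) := rfl
      rw [e, ← EReal.coe_add, EReal.coe_le_coe_iff] at hd
      have hq := q.2
      have hq' : (0:ℝ) ≤ q := hq
      refine ⟨by linarith, ?_⟩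
      rw [← ENNReal.ofReal_coe_nnreal]
      exact ENNReal.ofReal_le_ofReal (by linarith)
  have hI : Integrable (fun u => b + S.lam y u * g y - (Xg y + c * g y)) m :=
    ((integrable_const b).add (hint.mul_const _)).sub (integrable_const _)
  have h0 : 0 ≤ᵐ[m] fun u => b + S.lam y u * g y - (Xg y + c * g y) := by
    filter_upwards [h] with u hu using (hpt u hu).1
  have hv : ∫ u, (b + S.lam y u * g y - (Xg y + c * g y)) ∂m
      = b + (S.lamMix y m).toReal * g y - (Xg y + c * g y) := by
    have hI1 : Integrable (fun u => b + S.lam y u * g y) m :=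
      (integrable_const b).add (hint.mul_const _)
    rw [integral_sub hI1 (integrable_const _),
      integral_add (integrable_const b) (hint.mul_const _), integral_mul_const, hval]
    simp
  refine ⟨hv ▸ integral_nonneg_of_ae h0, ?_⟩
  rw [← hv, ofReal_integral_eq_lintegral_ofReal hI h0]
  refine lintegral_mono_ae ?_
  filter_upwards [h] with u hu using (hpt u hu).2

theorem ac_exp {f : ℝ → ℝ} {a b : ℝ} (hf : AbsolutelyContinuousOnInterval f a b) :
    AbsolutelyContinuousOnInterval (fun t => Real.exp (f t)) a b := by
  obtain ⟨C, hC⟩ := hf.exists_bound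
  have hL : ∀ s ∈ uIcc a b, ∀ t ∈ uIcc a b,
      dist (Real.exp (f s)) (Real.exp (f t)) ≤ Real.exp C * dist (f s) (f t) := by
    intro s hs t ht
    have := Convex.norm_image_sub_le_of_norm_hasDerivWithin_le (f := Real.exp) (f' := Real.exp)
      (C := Real.exp C) (s := Iic C)
      (fun y _ => (Real.hasDerivAt_exp y).hasDerivWithinAt)
      (fun y hy => by rw [Real.norm_eq_abs, Real.abs_exp]; exact Real.exp_le_exp.2 hy)
      (convex_Iic C) (x := f t) (y := f s) ((le_abs_self _).trans (hC t ht))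
      ((le_abs_self _).trans (hC s hs))
    simpa [dist_eq_norm] using this
  unfold AbsolutelyContinuousOnInterval at hf ⊢
  apply squeeze_zero' ?_ ?_ (by simpa using Tendsto.const_mul (Real.exp C) hf)
  · exact Eventually.of_forall fun t => Finset.sum_nonneg (fun i hi ↦ by positivity)
  · rw [eventually_inf_principal]
    refine Eventually.of_forall fun I hI => ?_
    rw [Finset.mul_sum]
    refine Finset.sum_le_sum fun i hi => ?_
    exact hL _ (hI.1 i hi).1 _ (hI.1 i hi).2

theorem ftc {T α : ℝ} (hT : 0 ≤ T) {l Xi G : ℝ → ℝ} (hl : IntervalIntegrable l volume 0 T)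
    (hX : IntervalIntegrable Xi volume 0 T)
    (hG : ∀ t ∈ Icc 0 T, G t = G 0 + ∫ s in (0:ℝ)..t, Xi s) :
    IntervalIntegrable (fun t => Real.exp (-(α * t) - ∫ s in (0:ℝ)..t, l s)
        * (Xi t - (α + l t) * G t)) volume 0 T ∧
    IntervalIntegrable (fun t => Real.exp (-(α * t) - ∫ s in (0:ℝ)..t, l s)) volume 0 T ∧
    ∫ t in (0:ℝ)..T, Real.exp (-(α * t) - ∫ s in (0:ℝ)..t, l s) * (Xi t - (α + l t) * G t)
      = Real.exp (-(α * T) - ∫ s in (0:ℝ)..T, l s) * G T - G 0 := by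
  have hu : uIcc 0 T = Icc 0 T := uIcc_of_le hT
  have a1 : AbsolutelyContinuousOnInterval (fun t : ℝ => -(α * t)) 0 T := by
    have : LipschitzWith ‖α‖₊ (fun t : ℝ => -(α * t)) := by
      apply LipschitzWith.of_dist_le_mul
      intro s t
      rw [Real.dist_eq, Real.dist_eq, coe_nnnorm, Real.norm_eq_abs, ← abs_mul]
      rw [← abs_neg]; apply le_of_eq; congr 1; ring
    exact this.lipschitzOnWith.absolutelyContinuousOnInterval
  have a2 := hl.absolutelyContinuousOnInterval_intervalIntegral (c := 0) (by simp)
  have aW := ac_exp (a1.fun_sub a2)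
  have aG' := hX.absolutelyContinuousOnInterval_intervalIntegral (c := 0) (by simp)
  have aG : AbsolutelyContinuousOnInterval (fun t => G 0 + ∫ s in (0:ℝ)..t, Xi s) 0 T :=
    (LipschitzWith.const (G 0)).lipschitzOnWith.absolutelyContinuousOnInterval.fun_add aG'
  have aF := aW.fun_mul aG
  have hd : ∀ᵐ t, t ∈ uIcc 0 T →
      deriv (fun t => Real.exp (-(α * t) - ∫ s in (0:ℝ)..t, l s) * (G 0 + ∫ s in (0:ℝ)..t, Xi s)) t
      = Real.exp (-(α * t) - ∫ s in (0:ℝ)..t, l s) * (Xi t - (α + l t) * G t) := by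
    filter_upwards [hl.ae_hasDerivAt_integral, hX.ae_hasDerivAt_integral] with t h1 h2 ht
    have d1 := h1 ht 0 (by simp)
    have d2 := h2 ht 0 (by simp)
    have d3 : HasDerivAt (fun t : ℝ => -(α * t)) (-α) t := by
      have := ((hasDerivAt_id t).const_mul α).fun_neg
      simpa using this
    have d4 := ((d3.sub d1).exp).mul (d2.const_add (G 0))
    have := d4.deriv
    rw [hG t (hu ▸ ht)]
    refine Eq.trans this ?_
    simp only [Pi.sub_apply]
    ring
  have hd' : ∀ᵐ t ∂volume.restrict (uIoc 0 T),
      deriv (fun t => Real.exp (-(α * t) - ∫ s in (0:ℝ)..t, l s) * (G 0 + ∫ s in (0:ℝ)..t, Xi s)) t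
      = Real.exp (-(α * t) - ∫ s in (0:ℝ)..t, l s) * (Xi t - (α + l t) * G t) := by
    rw [ae_restrict_iff' measurableSet_uIoc]
    filter_upwards [hd] with t ht h using ht (uIoc_subset_uIcc h)
  refine ⟨aF.intervalIntegrable_deriv.congr_ae hd', aW.continuousOn.intervalIntegrable, ?_⟩
  rw [← intervalIntegral.integral_congr_ae_restrict hd', aF.integral_deriv_eq_sub,
    ← hG T ⟨hT, le_rfl⟩]
  simp

section

variable [MetricSpace U] [BorelSpace U]

theorem ae_fs {S : Setting n U} (hS : Basic S) {x : Fin n → ℝ} (hx : x ∈ S.E)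
    {Θ : RControl U} (hΘ : S.IsRelaxed x Θ) :
    ∀ᵐ t ∂volume.restrict (S.fs x), S.φ x t ∈ S.E ∧ ∀ᵐ u ∂Θ.time t, u ∈ S.feas (S.φ x t) := by
  filter_upwards [hΘ.2.2.1, ae_restrict_mem (fs_meas S x)] with t h1 h2
  have := hΘ.2.1 t
  exact ⟨mem_E hS hx h2, ae_feas hS (subset_closure (mem_E hS hx h2)) h1⟩

theorem Lam_lt_top {S : Setting n U} (hS : Basic S) {x : Fin n → ℝ} (hx : x ∈ S.E)
    {Θ : RControl U} (hΘ : S.IsRelaxed x Θ) {T : ℝ}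
    (hT : (volume.restrict (Ioc 0 T)) ≤ volume.restrict (S.fs x))
    (hsup : (∫⁻ s in Set.Ioc (0 : ℝ) T,
      ⨆ a ∈ S.feas (S.φ x s), ENNReal.ofReal (S.lam (S.φ x s) a)) < ⊤) :
    S.Lam x Θ T < ⊤ := by
  refine lt_of_le_of_lt (lintegral_mono_ae ?_) hsup
  filter_upwards [ae_mono hT (ae_fs hS hx hΘ)] with t ht
  have := hΘ.2.1 t
  calc S.lamMix (S.φ x t) (Θ.time t)
      ≤ ∫⁻ _, (⨆ a ∈ S.feas (S.φ x t), ENNReal.ofReal (S.lam (S.φ x t) a)) ∂(Θ.time t) := by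
        refine lintegral_mono_ae ?_
        filter_upwards [ht.2] with u hu
        exact le_iSup₂ (f := fun a (_ : a ∈ S.feas (S.φ x t)) =>
          ENNReal.ofReal (S.lam (S.φ x t) a)) u hu
    _ = _ := by simp

theorem Lam_mono (S : Setting n U) (x : Fin n → ℝ) (Θ : RControl U) {s t : ℝ} (h : s ≤ t) :
    S.Lam x Θ s ≤ S.Lam x Θ t :=
  lintegral_mono_set (Ioc_subset_Ioc_right h)

theorem meas_lamMix {S : Setting n U} (hS : Basic S) (x : Fin n → ℝ)
    {Θ : RControl U} (hΘ : S.IsRelaxed x Θ) :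
    Measurable fun t => S.lamMix (S.φ x t) (Θ.time t) :=
  meas_mix (meas_lam hS) hS x hΘ

theorem meas_lamQMix {S : Setting n U} (hS : Basic S) (x : Fin n → ℝ)
    {Θ : RControl U} (hΘ : S.IsRelaxed x Θ) {k : (Fin n → ℝ) → ℝ≥0∞} (hk : Measurable k) :
    Measurable fun t => S.lamQMix k (S.φ x t) (Θ.time t) :=
  meas_mix (Y := fun y u => ENNReal.ofReal (S.lam y u) * S.Qpt k y u)
    ((meas_lam hS).mul (meas_Qpt hS hk)) hS x hΘ

theorem Lam_eq {S : Setting n U} (hS : Basic S) {x : Fin n → ℝ}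
    {Θ : RControl U} (hΘ : S.IsRelaxed x Θ) {T : ℝ} (hT : 0 ≤ T) (hfin : S.Lam x Θ T < ⊤) :
    IntervalIntegrable (fun t => (S.lamMix (S.φ x t) (Θ.time t)).toReal) volume 0 T ∧
    (∀ᵐ t ∂volume.restrict (Ioc 0 T), S.lamMix (S.φ x t) (Θ.time t) < ⊤) ∧
    ∀ t ∈ Icc 0 T, (S.Lam x Θ t).toReal
        = ∫ s in (0:ℝ)..t, (S.lamMix (S.φ x s) (Θ.time s)).toReal := by
  have hm := meas_lamMix hS x hΘ
  refine ⟨?_, ae_lt_top hm hfin.ne, ?_⟩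
  · rw [intervalIntegrable_iff_integrableOn_Ioc_of_le hT]
    exact integrable_toReal_of_lintegral_ne_top hm.aemeasurable hfin.ne
  · intro t ht
    have hf' := (Lam_mono S x Θ ht.2).trans_lt hfin
    rw [intervalIntegral.integral_of_le ht.1,
      integral_toReal hm.aemeasurable (ae_lt_top hm hf'.ne)]
    rfl

theorem weight_eq {S : Setting n U} (hS : Basic S) {x : Fin n → ℝ}
    {Θ : RControl U} (hΘ : S.IsRelaxed x Θ) {T : ℝ} (hT : 0 ≤ T) (hfin : S.Lam x Θ T < ⊤) (α : ℝ) :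
    ∀ t ∈ Icc 0 T, S.weight α x Θ t = ENNReal.ofReal (Real.exp (-(α * t) -
        ∫ s in (0:ℝ)..t, (S.lamMix (S.φ x s) (Θ.time s)).toReal)) := by
  intro t ht
  have hf' := (Lam_mono S x Θ ht.2).trans_lt hfin
  rw [Setting.weight, if_neg hf'.ne, (Lam_eq hS hΘ hT hfin).2.2 t ht]

theorem meas_weight (S : Setting n U) (α : ℝ) (x : Fin n → ℝ) (Θ : RControl U) :
    Measurable (S.weight α x Θ) := by
  have hL : Measurable (S.Lam x Θ) :=
    Monotone.measurable fun s t h => Lam_mono S x Θ h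
  refine Measurable.ite (hL (measurableSet_singleton ⊤)) measurable_const ?_
  refine ENNReal.measurable_ofReal.comp (Real.measurable_exp.comp ?_)
  exact ((measurable_id.const_mul α).neg).sub hL.ennreal_toReal

theorem weight_bound {S : Setting n U} (hS : Basic S) {x : Fin n → ℝ} (hx : x ∈ S.E)
    {Θ : RControl U} (hΘ : S.IsRelaxed x Θ) {c Kl α : ℝ} {lamL : (Fin n → ℝ) → ℝ}
    (hLR : LowerRate S c lamL Kl) (hα : -c ≤ α) :
    ∫⁻ t in S.fs x, S.weight α x Θ t ≤ ENNReal.ofReal Kl := by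
  refine le_trans (setLIntegral_mono' (fs_meas S x) fun t ht => ?_) (hLR.intBound x hx)
  have hfin := Lam_lt_top hS hx hΘ (restrict_le S ht) (hLR.supInt x hx t ht)
  rw [weight_eq hS hΘ ht.1 hfin α t ⟨ht.1, le_rfl⟩]
  refine ENNReal.ofReal_le_ofReal (Real.exp_le_exp.2 ?_)
  have h1 : -(α * t) ≤ c * t := by
    have := mul_le_mul_of_nonneg_right hα ht.1
    linarith
  have hE := Lam_eq hS hΘ ht.1 hfin
  have h2 : ∫ s in (0:ℝ)..t, lamL (S.φ x s)
      ≤ ∫ s in (0:ℝ)..t, (S.lamMix (S.φ x s) (Θ.time s)).toReal := by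
    rw [intervalIntegral.integral_of_le ht.1, intervalIntegral.integral_of_le ht.1]
    refine integral_mono_ae
      ((intervalIntegrable_iff_integrableOn_Ioc_of_le ht.1).1 (hLR.lamL_locInt x hx t ht))
      ((intervalIntegrable_iff_integrableOn_Ioc_of_le ht.1).1 hE.1) ?_
    filter_upwards [ae_mono (restrict_le S ht) (ae_fs hS hx hΘ), hE.2.1] with s hs hs'
    have := hΘ.2.1 s
    rw [← ENNReal.ofReal_le_iff_le_toReal hs'.ne]
    calc ENNReal.ofReal (lamL (S.φ x s)) = ∫⁻ _, ENNReal.ofReal (lamL (S.φ x s)) ∂(Θ.time s) := by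
          simp
      _ ≤ _ := by
          refine lintegral_mono_ae ?_
          filter_upwards [hs.2] with u hu
          exact ENNReal.ofReal_le_ofReal (hLR.lam_ge _ hs.1 u hu)
  linarith

theorem step {S : Setting n U} (hS : Basic S)
    {b c : ℝ} {g Xg rbar lamL : (Fin n → ℝ) → ℝ} {Kl : ℝ}
    (hEG : ExpGrowth S b c g Xg rbar) (hLR : LowerRate S c lamL Kl)
    {α : ℝ} (hα : -c ≤ α) {x : Fin n → ℝ} (hx : x ∈ S.E)
    {Θ : RControl U} (hΘ : S.IsRelaxed x Θ) {T : ℝ} (hT : T ∈ S.fs x) :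
    (∫⁻ t in Ioc 0 T, S.weight α x Θ t * (ENNReal.ofReal (c + α) * ENNReal.ofReal (g (S.φ x t))
        + S.lamQMix (fun z => ENNReal.ofReal (g z)) (S.φ x t) (Θ.time t)))
      + S.weight α x Θ T * ENNReal.ofReal (g (S.φ x T))
      ≤ ENNReal.ofReal (b * Kl) + ENNReal.ofReal (g x) := by
  have hT0 : 0 ≤ T := hT.1
  have hfin := Lam_lt_top hS hx hΘ (restrict_le S hT) (hLR.supInt x hx T hT)
  have hE := Lam_eq hS hΘ hT0 hfin
  have hw := weight_eq hS hΘ hT0 hfin α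
  have hgp : ∀ y, 0 ≤ g y := fun y => zero_le_one.trans (hEG.g_ge_one y)
  set l : ℝ → ℝ := fun t => (S.lamMix (S.φ x t) (Θ.time t)).toReal with hl
  set W : ℝ → ℝ := fun t => Real.exp (-(α * t) - ∫ s in (0:ℝ)..t, l s) with hW
  have hF := ftc (α := α) hT0 hE.1 (hEG.g_mac.2.2.1 x hx T hT).1 (G := fun t => g (S.φ x t)) (by
    intro t ht
    have := (hEG.g_mac.2.2.1 x hx t (mem_fs_mono ht.1 ht.2 hT)).2
    simp only [hS.flowZero]
    linarith)
  obtain ⟨hI, hWI, hint⟩ := hF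
  rw [intervalIntegrable_iff_integrableOn_Ioc_of_le hT0] at hI hWI
  rw [intervalIntegral.integral_of_le hT0] at hint
  simp only [hS.flowZero] at hint
  have hWp : ∀ t, 0 ≤ W t := fun t => (Real.exp_pos _).le
  have key : ∀ᵐ t ∂volume.restrict (Ioc 0 T),
      0 ≤ W t * b - W t * (Xg (S.φ x t) - (α + l t) * g (S.φ x t)) ∧
      S.weight α x Θ t * (ENNReal.ofReal (c + α) * ENNReal.ofReal (g (S.φ x t))
        + S.lamQMix (fun z => ENNReal.ofReal (g z)) (S.φ x t) (Θ.time t))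
      ≤ ENNReal.ofReal (W t * b - W t * (Xg (S.φ x t) - (α + l t) * g (S.φ x t))) := by
    filter_upwards [ae_mono (restrict_le S hT) (ae_fs hS hx hΘ), hE.2.1,
      ae_restrict_mem measurableSet_Ioc] with t h1 h2 h3
    have := hΘ.2.1 t
    obtain ⟨d1, d2⟩ := drift_int hS hEG h1.1 h1.2 h2
    have hca : 0 ≤ (c + α) * g (S.φ x t) := mul_nonneg (by linarith) (hgp _)
    have e : W t * b - W t * (Xg (S.φ x t) - (α + l t) * g (S.φ x t))
        = W t * ((c + α) * g (S.φ x t)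
          + (b + l t * g (S.φ x t) - (Xg (S.φ x t) + c * g (S.φ x t)))) := by ring
    rw [e]
    refine ⟨mul_nonneg (hWp t) (add_nonneg hca d1), ?_⟩
    rw [hw t ⟨h3.1.le, h3.2⟩, ENNReal.ofReal_mul (hWp t), ENNReal.ofReal_add hca d1,
      ENNReal.ofReal_mul (by linarith : 0 ≤ c + α)]
    gcongr
  have hdiff : Integrable (fun t => W t * b - W t * (Xg (S.φ x t) - (α + l t) * g (S.φ x t)))
      (volume.restrict (Ioc 0 T)) := (hWI.mul_const b).sub hI
  have hval : ∫ t in Ioc 0 T, (W t * b - W t * (Xg (S.φ x t) - (α + l t) * g (S.φ x t)))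
      = (∫ t in Ioc 0 T, W t) * b - (W T * g (S.φ x T) - g x) := by
    rw [integral_sub (hWI.mul_const b) hI, hint, integral_mul_const]
  have hnn : 0 ≤ᵐ[volume.restrict (Ioc 0 T)]
      fun t => W t * b - W t * (Xg (S.φ x t) - (α + l t) * g (S.φ x t)) :=
    key.mono fun t h => h.1
  have hWK : ∫ t in Ioc 0 T, W t ≤ Kl := by
    have h1 := (lintegral_mono' (restrict_le S hT) le_rfl).trans (weight_bound hS hx hΘ hLR hα)
    have h2 : ENNReal.ofReal (∫ t in Ioc 0 T, W t) = ∫⁻ t in Ioc 0 T, S.weight α x Θ t := by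
      rw [ofReal_integral_eq_lintegral_ofReal hWI (Eventually.of_forall hWp)]
      refine setLIntegral_congr_fun measurableSet_Ioc fun t ht => ?_
      exact (hw t ⟨ht.1.le, ht.2⟩).symm
    rw [← h2] at h1
    exact (ENNReal.ofReal_le_ofReal_iff hLR.Kl_nonneg).1 h1
  have hb := hEG.b_nonneg
  have hge := integral_nonneg_of_ae hnn
  calc _ ≤ (∫⁻ t in Ioc 0 T,
        ENNReal.ofReal (W t * b - W t * (Xg (S.φ x t) - (α + l t) * g (S.φ x t))))
        + ENNReal.ofReal (W T * g (S.φ x T)) := by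
        rw [hw T ⟨hT0, le_rfl⟩, ← ENNReal.ofReal_mul (hWp T)]
        gcongr ?_ + _
        exact lintegral_mono_ae (key.mono fun t h => h.2)
    _ = ENNReal.ofReal ((∫ t in Ioc 0 T, W t) * b + g x) := by
        rw [← ofReal_integral_eq_lintegral_ofReal hdiff hnn,
          ← ENNReal.ofReal_add hge (mul_nonneg (hWp T) (hgp _)), hval]
        congr 1; ring
    _ ≤ ENNReal.ofReal (b * Kl + g x) := by
        refine ENNReal.ofReal_le_ofReal ?_
        nlinarith
    _ = _ := ENNReal.ofReal_add (mul_nonneg hb hLR.Kl_nonneg) (hgp x)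

end

end PDMPaux

theorem corollary_3_3_intLHG {n : ℕ} {U : Type*} [MeasurableSpace U] [MetricSpace U]
    [CompactSpace U] [BorelSpace U]
    (S : Setting n U) (hS : Basic S)
    (b c : ℝ) (g Xg rbar lamL : (Fin n → ℝ) → ℝ) (Kl : ℝ)
    (hEG : ExpGrowth S b c g Xg rbar) (hLR : LowerRate S c lamL Kl)
    (α : ℝ) (hα : -c ≤ α) (x : Fin n → ℝ) (hx : x ∈ S.E)
    (Θ : RControl U) (hΘ : S.IsRelaxed x Θ) :
    ENNReal.ofReal (c + α) * S.Lop α (fun y _ => ENNReal.ofReal (g y)) x Θ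
        + S.Hop α (fun z _ => ENNReal.ofReal (rbar z)) x Θ
        + S.Gop α (fun z => ENNReal.ofReal (g z)) x Θ
      ≤ ENNReal.ofReal (b * Kl) + ENNReal.ofReal (g x) := by
  have hgm : Measurable fun z => ENNReal.ofReal (g z) :=
    ENNReal.measurable_ofReal.comp hEG.g_mac.1
  have hwm := PDMPaux.meas_weight S α x Θ
  have hgx : Measurable fun t => ENNReal.ofReal (g (S.φ x t)) :=
    hgm.comp (PDMPaux.cont_flow hS x).measurable
  set F : ℝ → ℝ≥0∞ := fun t =>
    S.weight α x Θ t * (ENNReal.ofReal (c + α) * ENNReal.ofReal (g (S.φ x t))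
        + S.lamQMix (fun z => ENNReal.ofReal (g z)) (S.φ x t) (Θ.time t)) with hF
  have hsum : ENNReal.ofReal (c + α) * S.Lop α (fun y _ => ENNReal.ofReal (g y)) x Θ
      + S.Lop α (fun y m => S.lamQMix (fun z => ENNReal.ofReal (g z)) y m) x Θ
      = ∫⁻ t in S.fs x, F t := by
    have hm : Measurable fun t => S.weight α x Θ t * ENNReal.ofReal (g (S.φ x t)) := hwm.mul hgx
    rw [Setting.Lop, Setting.Lop, ← lintegral_const_mul _ hm,
      ← lintegral_add_left (hm.const_mul _)]
    refine lintegral_congr fun t => ?_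
    simp only [hF]
    ring
  obtain ⟨u, hu, humem, hulim⟩ := exists_seq_strictMono_tendsto' (PDMPaux.ts_pos hS hx)
  set T : ℕ → ℝ := fun k => (u k).toReal with hTdef
  have hufin : ∀ k, u k ≠ ⊤ := fun k => ((humem k).2.trans_le le_top).ne
  have hTfs : ∀ k, T k ∈ S.fs x := fun k =>
    ⟨ENNReal.toReal_nonneg, by rw [hTdef, ENNReal.ofReal_toReal (hufin k)]; exact (humem k).2⟩
  have hTmono : Monotone T := fun i j h =>
    ENNReal.toReal_mono (hufin j) (hu.monotone h)
  have hunion : S.fs x =ᵐ[volume] ⋃ k, Ioc 0 (T k) := by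
    have hsub : (⋃ k, Ioc 0 (T k)) = S.fs x \ {0} := by
      ext t
      simp only [mem_iUnion, mem_Ioc, Set.mem_sdiff, mem_singleton_iff]
      constructor
      · rintro ⟨k, h0, hk⟩
        exact ⟨PDMPaux.mem_fs_mono h0.le hk (hTfs k), h0.ne'⟩
      · rintro ⟨⟨h0, h1⟩, hne⟩
        obtain ⟨k, hk⟩ := (hulim.eventually (lt_mem_nhds h1)).exists
        exact ⟨k, lt_of_le_of_ne h0 (Ne.symm hne),
          ((ENNReal.ofReal_lt_iff_lt_toReal h0 (hufin k)).1 hk).le⟩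
    rw [hsub]
    exact (sdiff_null_ae_eq_self (by simp)).symm
  have hdir : Monotone fun k => Ioc 0 (T k) := fun i j h => Ioc_subset_Ioc_right (hTmono h)
  have hA : ∫⁻ t in S.fs x, F t = ⨆ k, ∫⁻ t in Ioc 0 (T k), F t := by
    rw [setLIntegral_congr hunion, setLIntegral_iUnion_of_directed _ hdir.directed_le]
  have hAlim : Tendsto (fun k => ∫⁻ t in Ioc 0 (T k), F t) atTop (𝓝 (∫⁻ t in S.fs x, F t)) := by
    rw [hA]
    exact tendsto_atTop_iSup fun i j h => lintegral_mono_set (hdir h)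
  have hstep : ∀ k, (∫⁻ t in Ioc 0 (T k), F t)
      + S.weight α x Θ (T k) * ENNReal.ofReal (g (S.φ x (T k)))
      ≤ ENNReal.ofReal (b * Kl) + ENNReal.ofReal (g x) := fun k =>
    PDMPaux.step hS hEG hLR hα hx hΘ (hTfs k)
  have hre : ENNReal.ofReal (c + α) * S.Lop α (fun y _ => ENNReal.ofReal (g y)) x Θ
        + S.Hop α (fun z _ => ENNReal.ofReal (rbar z)) x Θ
        + S.Gop α (fun z => ENNReal.ofReal (g z)) x Θ
      = (∫⁻ t in S.fs x, F t) + (S.Hop α (fun z _ => ENNReal.ofReal (rbar z)) x Θ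
        + S.Hop α (fun y m => S.QMix (fun z => ENNReal.ofReal (g z)) y m) x Θ) := by
    rw [← hsum, Setting.Gop]; ring
  rw [hre]
  by_cases hts : S.ts x < ⊤
  · have hpos : 0 < S.tsR x := ENNReal.toReal_pos (PDMPaux.ts_pos hS hx).ne' hts.ne
    have hfin := PDMPaux.Lam_lt_top hS hx hΘ (PDMPaux.restrict_le' S hts) (hLR.supIntTs x hx hts)
    have hE := PDMPaux.Lam_eq hS hΘ hpos.le hfin
    have hw := PDMPaux.weight_eq hS hΘ hpos.le hfin α
    have hTlt : ∀ k, T k < S.tsR x := fun k =>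
      (ENNReal.toReal_lt_toReal (hufin k) hts.ne).2 (humem k).2
    have hTlim : Tendsto T atTop (𝓝 (S.tsR x)) :=
      (ENNReal.tendsto_toReal hts.ne).comp hulim
    have hTlim' : Tendsto T atTop (𝓝[<] (S.tsR x)) :=
      tendsto_nhdsWithin_iff.2 ⟨hTlim, Eventually.of_forall hTlt⟩
    have hTlim'' : Tendsto T atTop (𝓝[Icc 0 (S.tsR x)] (S.tsR x)) :=
      tendsto_nhdsWithin_iff.2
        ⟨hTlim, Eventually.of_forall fun k => ⟨(hTfs k).1, (hTlt k).le⟩⟩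
    have hglim := (hEG.g_mac.2.2.2 x hx hts).comp hTlim'
    have hcont : ContinuousOn (fun t => Real.exp (-(α * t) -
        ∫ s in (0:ℝ)..t, (S.lamMix (S.φ x s) (Θ.time s)).toReal)) (Icc 0 (S.tsR x)) := by
      have h1 : ContinuousOn (fun t => ∫ s in (0:ℝ)..t, (S.lamMix (S.φ x s) (Θ.time s)).toReal)
          (uIcc 0 (S.tsR x)) :=
        (hE.1.absolutelyContinuousOnInterval_intervalIntegral (c := 0) (by simp)).continuousOn
      rw [uIcc_of_le hpos.le] at h1
      exact Real.continuous_exp.comp_continuousOn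
        ((continuous_const.mul continuous_id).neg.continuousOn.sub h1)
    have hWlim := (hcont (S.tsR x) ⟨hpos.le, le_rfl⟩).tendsto.comp hTlim''
    have hBlim : Tendsto (fun k => S.weight α x Θ (T k) * ENNReal.ofReal (g (S.φ x (T k)))) atTop
        (𝓝 (S.weight α x Θ (S.tsR x) * ENNReal.ofReal (g (S.φ x (S.tsR x))))) := by
      have h2 := ENNReal.tendsto_ofReal (hWlim.mul hglim)
      rw [hw _ ⟨hpos.le, le_rfl⟩, ← ENNReal.ofReal_mul (Real.exp_pos _).le]
      refine h2.congr fun k => ?_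
      rw [hw _ ⟨(hTfs k).1, (hTlt k).le⟩, ← ENNReal.ofReal_mul (Real.exp_pos _).le]
      rfl
    refine le_trans ?_ (le_of_tendsto' (hAlim.add hBlim) hstep)
    gcongr
    simp only [Setting.Hop, if_pos hts]
    rw [← mul_add]
    gcongr
    have := hΘ.2.2.2.1
    have hfe := PDMPaux.ae_feas hS (PDMPaux.tsR_closure hS hx hts) (hΘ.2.2.2.2 hts)
    calc ENNReal.ofReal (rbar (S.φ x (S.tsR x)))
          + S.QMix (fun z => ENNReal.ofReal (g z)) (S.φ x (S.tsR x)) Θ.bdry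
        = ∫⁻ u, (ENNReal.ofReal (rbar (S.φ x (S.tsR x)))
          + S.Qpt (fun z => ENNReal.ofReal (g z)) (S.φ x (S.tsR x)) u) ∂Θ.bdry := by
          rw [lintegral_add_left measurable_const]; simp [Setting.QMix]
      _ ≤ ∫⁻ _, ENNReal.ofReal (g (S.φ x (S.tsR x))) ∂Θ.bdry := by
          refine lintegral_mono_ae ?_
          filter_upwards [hfe] with u hu using hEG.bdryGrowth x hx hts u hu
      _ = _ := by simp
  · simp only [Setting.Hop, if_neg hts, add_zero]
    exact le_of_tendsto' hAlim fun k => le_self_add.trans (hstep k)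
end
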